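/- arXiv:2011.13496 — 3 statements merged into one kernel-verified Lean document; each statement's English description precedes it below -/
import Mathlib

section
/- Consider the two-sample testing problem with alternative parameters ε = ε_n ∈ (0,1/2) and μ = μ_n > 0 possibly varying with n. Suppose there is a sequence t_n → ∞ such that n · max(\bar F(t_n), ε_n \bar F(t_n − μ_n)) / (log n)^2 → ∞ and √n ε_n (\bar F(t_n − μ_n) − \bar F(t_n)) / (√(\bar F(t_n) + ε_n η \bar F(t_n − μ_n)) · log n) → ∞. Then the two-sample higher criticism test that rejects when HC ≥ log n is asymptotically powerful: its type I error probability under H0 tends to 0 and its power under H1 tends to 1 as n → ∞. -/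
open MeasureTheory ProbabilityTheory Filter Set Topology

/-- Empirical CDF of a sample of size `k`. -/
noncomputable def empCDF {k : ℕ} (x : Fin k → ℝ) (t : ℝ) : ℝ :=
  ((Finset.univ.filter fun i => x i ≤ t).card : ℝ) / k

/-- Pooled empirical CDF `H_{m+n}(t) = (m F_m(t) + n G_n(t))/(m+n)`. -/
noncomputable def pooledCDF {m n : ℕ} (x : Fin m → ℝ) (y : Fin n → ℝ) (t : ℝ) : ℝ :=
  ((m : ℝ) * empCDF x t + (n : ℝ) * empCDF y t) / ((m : ℝ) + n)

/-- The two-sample higher criticism statistic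
`HC = sup_t √(mn/(m+n)) (F_m(t) − G_n(t)) / √(H_{m+n}(t)(1 − H_{m+n}(t)))`. -/
noncomputable def HCstat {m n : ℕ} (x : Fin m → ℝ) (y : Fin n → ℝ) : ℝ :=
  ⨆ t : ℝ, Real.sqrt (((m : ℝ) * n) / ((m : ℝ) + n)) * (empCDF x t - empCDF y t) /
    Real.sqrt (pooledCDF x y t * (1 - pooledCDF x y t))

section HCproof

/-- Count of the entries related to `z`. -/
noncomputable def hcCount (r : ℝ → ℝ → Prop) {k : ℕ} (x : Fin k → ℝ) (z : ℝ) : ℝ :=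
  ∑ i, Set.indicator {w | r w z} (fun _ => (1:ℝ)) (x i)

lemma hc_lintegral_pow (P : Measure ℝ) [IsProbabilityMeasure P] (f : ℝ → ENNReal)
    (hf : Measurable f) (n : ℕ) :
    ∫⁻ x, ∏ i, f (x i) ∂(Measure.pi fun _ : Fin n => P) = (∫⁻ x, f x ∂P) ^ n := by
  induction n with
  | zero => simp
  | succ n ih =>
    have hmp := measurePreserving_piFinSuccAbove (fun _ : Fin (n+1) => P) 0
    have := hmp.lintegral_comp (f := fun p : ℝ × (Fin n → ℝ) => f p.1 * ∏ i, f (p.2 i))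
      (by fun_prop)
    have h2 : ∀ x : Fin (n+1) → ℝ, ∏ i, f (x i) =
        f ((MeasurableEquiv.piFinSuccAbove (fun _ : Fin (n+1) => ℝ) 0) x).1 *
        ∏ i, f (((MeasurableEquiv.piFinSuccAbove (fun _ : Fin (n+1) => ℝ) 0) x).2 i) := by
      intro x
      rw [Fin.prod_univ_succAbove _ 0]
      rfl
    simp_rw [h2]
    rw [this, lintegral_prod_mul (f := f) (g := fun y : Fin n → ℝ => ∏ i, f (y i)) hf.aemeasurable (Measurable.aemeasurable (by fun_prop)), ih, pow_succ, mul_comm]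

/-- The exponential weight. -/
noncomputable def hcG (r : ℝ → ℝ → Prop) (a : ℝ) (x z : ℝ) : ENNReal :=
  ENNReal.ofReal (Real.exp (a * Set.indicator {w | r w z} (fun _ => (1:ℝ)) x))

lemma hc_meas_ind (r : ℝ → ℝ → Prop) (hr : MeasurableSet {p : ℝ × ℝ | r p.1 p.2}) :
    Measurable fun p : ℝ × ℝ => Set.indicator {w | r w p.2} (fun _ => (1:ℝ)) p.1 := by
  have : (fun p : ℝ × ℝ => Set.indicator {w | r w p.2} (fun _ => (1:ℝ)) p.1)
      = Set.indicator {p : ℝ × ℝ | r p.1 p.2} (fun _ => (1:ℝ)) := by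
    ext p; simp [Set.indicator]
  rw [this]
  exact measurable_const.indicator hr

lemma hc_meas_G (r : ℝ → ℝ → Prop) (hr : MeasurableSet {p : ℝ × ℝ | r p.1 p.2}) (a : ℝ) :
    Measurable fun p : ℝ × ℝ => hcG r a p.1 p.2 := by
  unfold hcG
  have := hc_meas_ind r hr
  fun_prop

lemma hc_G_int (P : Measure ℝ) [IsProbabilityMeasure P]
    (r : ℝ → ℝ → Prop) (hr : MeasurableSet {p : ℝ × ℝ | r p.1 p.2}) (a z : ℝ) :
    ∫⁻ x, hcG r a x z ∂P ≤
      ENNReal.ofReal (Real.exp ((P {w | r w z}).toReal * (Real.exp a - 1))) := by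
  have hm : MeasurableSet {w | r w z} := (measurable_prodMk_right (y := z)) hr
  set S := {w | r w z} with hS
  have h1 : ∀ x, hcG r a x z = S.indicator (fun _ => ENNReal.ofReal (Real.exp a)) x +
      Sᶜ.indicator (fun _ => 1) x := by
    intro x
    by_cases hx : x ∈ S <;> simp [hcG, ← hS, hx]
  simp_rw [h1]
  rw [lintegral_add_left (measurable_const.indicator hm), lintegral_indicator_const hm,
    lintegral_indicator_const hm.compl, one_mul]
  have h2 : P S = ENNReal.ofReal (P S).toReal := by simp
  have h3 : P Sᶜ = ENNReal.ofReal (1 - (P S).toReal) := by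
    rw [prob_compl_eq_one_sub hm, ENNReal.ofReal_sub _ (by positivity)]; simp
  have hp1 : (P S).toReal ≤ 1 := measureReal_le_one
  have hp0 : 0 ≤ (P S).toReal := ENNReal.toReal_nonneg
  generalize (P S).toReal = p at *
  rw [h3, h2]
  rw [← ENNReal.ofReal_mul (by positivity), ← ENNReal.ofReal_add (by positivity) (by linarith)]
  apply ENNReal.ofReal_le_ofReal
  have := Real.add_one_le_exp (p * (Real.exp a - 1))
  linarith

lemma hc_hoeff (m n : ℝ) (hm : 0 < m) (hn : 0 ≤ n) (l : ℝ) (hl : 0 ≤ l) (hl1 : l ≤ 1) :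
    m * (Real.exp (l * n / (m+n) - l^2) - 1) + n * (Real.exp (-(l * m / (m+n)) - l^2) - 1) ≤ 0 := by
  have key : ∀ x : ℝ, |x| ≤ l → Real.exp x ≤ 1 + x + l^2 := by
    intro x hx
    have h := (abs_le.mp (Real.abs_exp_sub_one_sub_id_le (hx.trans hl1))).2
    have : x^2 ≤ l^2 := by rw [← sq_abs]; gcongr
    linarith
  have hN : 0 < m + n := by positivity
  have e1 := key (l * n / (m+n)) (by
    rw [abs_of_nonneg (by positivity), div_le_iff₀ hN]; nlinarith)
  have e2 := key (-(l * m / (m+n))) (by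
    rw [abs_neg, abs_of_nonneg (by positivity), div_le_iff₀ hN]; nlinarith)
  have h3 : m * Real.exp (l * n / (m+n)) + n * Real.exp (-(l * m / (m+n))) ≤ (m+n) * (1 + l^2) := by
    calc _ ≤ m * (1 + l * n / (m+n) + l^2) + n * (1 + -(l * m / (m+n)) + l^2) := by gcongr
      _ = _ := by field_simp; ring
  have h4 : 1 + l^2 ≤ Real.exp (l^2) := by linarith [Real.add_one_le_exp (l^2)]
  have h5 : m * Real.exp (l * n / (m+n)) + n * Real.exp (-(l * m / (m+n))) ≤
      (m+n) * Real.exp (l^2) := h3.trans (by gcongr)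
  rw [Real.exp_sub, Real.exp_sub]
  have h6 : 0 < Real.exp (l^2) := Real.exp_pos _
  have : (m * Real.exp (l * n / (m+n)) + n * Real.exp (-(l * m / (m+n)))) / Real.exp (l^2) ≤ m + n := by
    rw [div_le_iff₀ h6]; exact h5
  have e : (m * Real.exp (l * n / (m+n)) + n * Real.exp (-(l * m / (m+n)))) / Real.exp (l^2) =
    m * (Real.exp (l * n / (m+n)) / Real.exp (l^2)) + n * (Real.exp (-(l * m / (m+n))) / Real.exp (l^2)) := by ring
  rw [e] at this
  linarith

lemma hc_mgf (P : Measure ℝ) [IsProbabilityMeasure P]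
    (r : ℝ → ℝ → Prop) (hr : MeasurableSet {p : ℝ × ℝ | r p.1 p.2}) (m n : ℕ) (j : Fin m)
    (l : ℝ) (hl : 0 ≤ l) (hl1 : l ≤ 1) :
    ∫⁻ ω, (∏ i, hcG r (l * n / (m+n) - l^2) (ω.1 i) (ω.1 j)) *
        ∏ i, hcG r (-(l * m / (m+n)) - l^2) (ω.2 i) (ω.1 j)
      ∂((Measure.pi fun _ : Fin m => P).prod (Measure.pi fun _ : Fin n => P)) ≤
      ENNReal.ofReal (Real.exp 2) := by
  obtain _ | m := m
  · exact j.elim0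
  set a := l * n / ((m+1:ℕ)+n) - l^2 with ha
  set b := (-(l * (m+1:ℕ) / ((m+1:ℕ)+n)) - l^2) with hb
  have hG := hc_meas_G r hr
  have hGx : ∀ a, ∀ z, Measurable fun x => hcG r a x z := fun a z =>
    (hG a).comp (measurable_prodMk_right (y := z))
  have hGc : ∀ a, ∀ {α : Type} [MeasurableSpace α] (f g : α → ℝ), Measurable f → Measurable g →
      Measurable fun x => hcG r a (f x) (g x) := fun a α _ f g hf hg =>
    (hG a).comp (hf.prodMk hg)
  rw [lintegral_prod]
  swap
  · apply Measurable.aemeasurable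
    apply Measurable.mul
    · exact Finset.measurable_fun_prod _ fun i _ => hGc _ _ _ (by fun_prop) (by fun_prop)
    · exact Finset.measurable_fun_prod _ fun i _ => hGc _ _ _ (by fun_prop) (by fun_prop)
  have step : ∀ x : Fin (m+1) → ℝ, ∫⁻ y, (∏ i, hcG r a (x i) (x j)) *
        ∏ i, hcG r b (y i) (x j) ∂(Measure.pi fun _ : Fin n => P)
      = (∏ i, hcG r a (x i) (x j)) * (∫⁻ w, hcG r b w (x j) ∂P) ^ n := by
    intro x
    rw [lintegral_const_mul _ (Finset.measurable_fun_prod _ fun i _ => hGc _ _ _ (by fun_prop) (by fun_prop)),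
      hc_lintegral_pow P _ (hGx b (x j))]
  simp_rw [step]
  have hmp := measurePreserving_piFinSuccAbove (fun _ : Fin (m+1) => P) j
  have hJ : ∀ b, Measurable fun z => ∫⁻ w, hcG r b w z ∂P := fun b =>
    Measurable.lintegral_prod_left (f := hcG r b) (hG b)
  have hmf : Measurable (fun p : ℝ × (Fin m → ℝ) => hcG r a p.1 p.1 *
        (∏ i, hcG r a (p.2 i) p.1) * (∫⁻ w, hcG r b w p.1 ∂P) ^ n) := by
    refine Measurable.mul (Measurable.mul (hGc _ _ _ (by fun_prop) (by fun_prop)) ?_) ?_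
    · exact Finset.measurable_fun_prod _ fun i _ => hGc _ _ _ (by fun_prop) (by fun_prop)
    · exact ((hJ b).comp measurable_fst).pow_const n
  have := hmp.lintegral_comp hmf
  have h2 : ∀ x : Fin (m+1) → ℝ, (∏ i, hcG r a (x i) (x j)) * (∫⁻ w, hcG r b w (x j) ∂P) ^ n =
      (fun p : ℝ × (Fin m → ℝ) => hcG r a p.1 p.1 *
        (∏ i, hcG r a (p.2 i) p.1) * (∫⁻ w, hcG r b w p.1 ∂P) ^ n)
      ((MeasurableEquiv.piFinSuccAbove (fun _ : Fin (m+1) => ℝ) j) x) := by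
    intro x
    rw [Fin.prod_univ_succAbove _ j]
    rfl
  simp_rw [h2]
  rw [this, lintegral_prod _ hmf.aemeasurable]
  calc _ ≤ ∫⁻ z, ENNReal.ofReal (Real.exp 2) ∂P := by
        apply lintegral_mono
        intro z
        simp only
        have : ∀ y : Fin m → ℝ, hcG r a z z * (∏ i, hcG r a (y i) z) * (∫⁻ w, hcG r b w z ∂P) ^ n =
          (hcG r a z z * (∫⁻ w, hcG r b w z ∂P) ^ n) * (∏ i, hcG r a (y i) z) := fun y => by ring
        simp_rw [this]
        rw [lintegral_const_mul _ (Finset.measurable_fun_prod _ fun i _ => hGc _ _ _ (by fun_prop) (by fun_prop)),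
          hc_lintegral_pow P _ (hGx a z)]
        have hal : a ≤ 1 := by
          have : l * n / ((m+1:ℕ)+n) ≤ l := by
            rw [div_le_iff₀ (by positivity)]
            have : (n:ℝ) ≤ ((m+1:ℕ)+n) := by push_cast; linarith [(Nat.cast_nonneg m : (0:ℝ) ≤ m)]
            gcongr
          nlinarith [sq_nonneg l]
        have g1 : hcG r a z z ≤ ENNReal.ofReal (Real.exp 1) := by
          unfold hcG
          apply ENNReal.ofReal_le_ofReal
          rw [Real.exp_le_exp]
          by_cases h : z ∈ {w | r w z}
          · rw [Set.indicator_of_mem h]; linarith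
          · rw [Set.indicator_of_notMem h]; linarith
        set p := (P {w | r w z}).toReal with hp
        have hp0 : 0 ≤ p := ENNReal.toReal_nonneg
        have hp1 : p ≤ 1 := measureReal_le_one
        calc _ ≤ (ENNReal.ofReal (Real.exp 1) * (ENNReal.ofReal (Real.exp (p * (Real.exp b - 1)))) ^ n)
              * (ENNReal.ofReal (Real.exp (p * (Real.exp a - 1)))) ^ m := by
              gcongr
              · exact hc_G_int P r hr b z
              · exact hc_G_int P r hr a z
          _ = ENNReal.ofReal (Real.exp (1 + n * (p * (Real.exp b - 1)) + m * (p * (Real.exp a - 1)))) := by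
              rw [← ENNReal.ofReal_pow (by positivity), ← ENNReal.ofReal_pow (by positivity),
                ← ENNReal.ofReal_mul (by positivity), ← ENNReal.ofReal_mul (by positivity),
                ← Real.exp_nat_mul, ← Real.exp_nat_mul, ← Real.exp_add, ← Real.exp_add]
          _ ≤ _ := by
              apply ENNReal.ofReal_le_ofReal
              rw [Real.exp_le_exp]
              have := hc_hoeff ((m+1:ℕ):ℝ) n (by positivity) (by positivity) l hl hl1
              rw [← ha, ← hb] at this
              have h7 := mul_nonpos_of_nonneg_of_nonpos hp0 this
              push_cast at h7
              have h8 : p * (1 - Real.exp a) ≤ 1 := by nlinarith [Real.exp_pos a]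
              nlinarith
    _ = _ := by simp

/-- The bad event for index `j`. -/
def hcBad (r : ℝ → ℝ → Prop) (v : ℝ) {m n : ℕ} (x : Fin m → ℝ) (y : Fin n → ℝ) (z : ℝ) : Prop :=
  0 < n * hcCount r x z - m * hcCount r y z ∧
  v * (hcCount r x z + hcCount r y z) * (m + n) ^ 2 ≤ (n * hcCount r x z - m * hcCount r y z) ^ 2

lemma hc_count_nat (r : ℝ → ℝ → Prop) {k : ℕ} (x : Fin k → ℝ) (z : ℝ) :
    ∃ c : ℕ, c ≤ k ∧ hcCount r x z = c := by
  classical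
  refine ⟨(Finset.univ.filter fun i => r (x i) z).card, ?_, ?_⟩
  · exact (Finset.card_filter_le _ _).trans (by simp)
  · simp [hcCount, Set.indicator_apply]

lemma hc_prodG (r : ℝ → ℝ → Prop) {k : ℕ} (x : Fin k → ℝ) (z a : ℝ) :
    ∏ i, hcG r a (x i) z = ENNReal.ofReal (Real.exp (a * hcCount r x z)) := by
  unfold hcG hcCount
  rw [← ENNReal.ofReal_prod_of_nonneg (fun _ _ => (Real.exp_pos _).le), ← Real.exp_sum,
    Finset.mul_sum]

lemma hc_bad_prob (P : Measure ℝ) [IsProbabilityMeasure P]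
    (r : ℝ → ℝ → Prop) (hr : MeasurableSet {p : ℝ × ℝ | r p.1 p.2}) (m n : ℕ)
    (v : ℝ) (hv : 0 < v) :
    ((Measure.pi fun _ : Fin m => P).prod (Measure.pi fun _ : Fin n => P))
      {ω | ∃ j, hcBad r v ω.1 ω.2 (ω.1 j)} ≤
      ENNReal.ofReal (m * (m + n + 1) * Real.exp (2 - v / 4)) := by
  set u := Real.sqrt v with hu
  have hu0 : 0 < u := Real.sqrt_pos.mpr hv
  have huv : u ^ 2 = v := Real.sq_sqrt hv.le
  let l : ℕ → ℝ := fun k => min 1 (u / (2 * Real.sqrt k))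
  have hl0 : ∀ k, 0 ≤ l k := fun k => le_min zero_le_one (by positivity)
  have hl1 : ∀ k, l k ≤ 1 := fun k => min_le_left _ _
  let f : Fin m → ℕ → ((Fin m → ℝ) × (Fin n → ℝ)) → ENNReal := fun j k ω =>
    (∏ i, hcG r (l k * n / (m+n) - l k ^2) (ω.1 i) (ω.1 j)) *
        ∏ i, hcG r (-(l k * m / (m+n)) - l k ^2) (ω.2 i) (ω.1 j)
  have hsub : {ω : (Fin m → ℝ) × (Fin n → ℝ) | ∃ j, hcBad r v ω.1 ω.2 (ω.1 j)} ⊆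
      ⋃ j ∈ (Finset.univ : Finset (Fin m)), ⋃ k ∈ Finset.range (m + n + 1),
        {ω | ENNReal.ofReal (Real.exp (v/4)) ≤ f j k ω} := by
    rintro ⟨x, y⟩ ⟨j, h1, h2⟩
    simp only at h1 h2
    obtain ⟨A, hA, hA'⟩ := hc_count_nat r x (x j)
    obtain ⟨B, hB, hB'⟩ := hc_count_nat r y (x j)
    simp only [Set.mem_iUnion]
    refine ⟨j, Finset.mem_univ _, A + B, Finset.mem_range.mpr (by omega), ?_⟩
    simp only [Set.mem_ofPred_eq, f]
    rw [hc_prodG, hc_prodG, ← ENNReal.ofReal_mul (by positivity), ← Real.exp_add]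
    apply ENNReal.ofReal_le_ofReal
    rw [Real.exp_le_exp]
    rw [hA', hB'] at h1 h2 ⊢
    have hm0 : 0 < m := lt_of_le_of_lt (Nat.zero_le _) j.2
    have hN : (0:ℝ) < m + n := by positivity
    set s : ℝ := (n * A - m * B) / (m + n) with hs
    have hs0 : 0 < s := div_pos h1 hN
    set k : ℝ := (A:ℝ) + B with hk
    have hs2 : v * k ≤ s ^ 2 := by
      rw [hs, div_pow, le_div_iff₀ (by positivity)]; exact h2
    have hA0 : (0:ℝ) ≤ A := by positivity
    have hB0 : (0:ℝ) ≤ B := by positivity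
    have hsk : s ≤ k := by
      rw [hs, div_le_iff₀ hN, hk]
      have : (0:ℝ) ≤ m * A := by positivity
      have : (0:ℝ) ≤ m * B := by positivity
      have : (0:ℝ) ≤ n * B := by positivity
      nlinarith
    have hk0 : 0 < k := hs0.trans_le hsk
    set q := Real.sqrt k with hq
    have hq0 : 0 < q := Real.sqrt_pos.mpr hk0
    have hqk : q ^ 2 = k := Real.sq_sqrt hk0.le
    have hsq : u * q ≤ s := by
      apply (sq_le_sq₀ (by positivity) hs0.le).mp
      rw [mul_pow, huv, hqk]; exact hs2
    have huq : u ≤ q := by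
      have : u * q ≤ q * q := by nlinarith
      exact le_of_mul_le_mul_right this hq0
    have hlk : l (A + B) = u / (2 * q) := by
      simp only [l]
      push_cast
      rw [← hk, ← hq]
      apply min_eq_right
      rw [div_le_one (by positivity)]; linarith
    rw [hlk]
    have e : (u / (2*q) * n / (m+n) - (u / (2*q))^2) * A + (-(u / (2*q) * m / (m+n)) - (u / (2*q))^2) * B
        = u / (2*q) * s - (u / (2*q))^2 * k := by
      rw [hs, hk]; field_simp; ring
    rw [e]
    have e2 : (u / (2*q))^2 * k = v / 4 := by
      rw [div_pow, huv, mul_pow, hqk]; field_simp; norm_num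
    have e3 : v / 2 ≤ u / (2*q) * s := by
      calc v / 2 = u / (2*q) * (u * q) := by rw [← huv]; field_simp
        _ ≤ _ := by gcongr
    linarith
  have hfm : ∀ j k, Measurable (f j k) := by
    intro j k
    have hG := hc_meas_G r hr
    apply Measurable.mul
    · exact Finset.measurable_fun_prod _ fun i _ =>
        (hG _).comp (Measurable.prodMk (by fun_prop) (by fun_prop))
    · exact Finset.measurable_fun_prod _ fun i _ =>
        (hG _).comp (Measurable.prodMk (by fun_prop) (by fun_prop))
  have hone : ∀ j k, ((Measure.pi fun _ : Fin m => P).prod (Measure.pi fun _ : Fin n => P))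
      {ω | ENNReal.ofReal (Real.exp (v/4)) ≤ f j k ω} ≤ ENNReal.ofReal (Real.exp (2 - v/4)) := by
    intro j k
    refine (meas_ge_le_lintegral_div (hfm j k).aemeasurable (by positivity) (by simp)).trans ?_
    rw [Real.exp_sub, ENNReal.ofReal_div_of_pos (Real.exp_pos _)]
    gcongr
    exact hc_mgf P r hr m n j (l k) (hl0 k) (hl1 k)
  refine (measure_mono hsub).trans ?_
  refine (measure_biUnion_finset_le _ _).trans ?_
  calc _ ≤ ∑ j : Fin m, ∑ k ∈ Finset.range (m+n+1), ENNReal.ofReal (Real.exp (2 - v/4)) := by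
        apply Finset.sum_le_sum
        intro j _
        refine (measure_biUnion_finset_le _ _).trans ?_
        exact Finset.sum_le_sum fun k _ => hone j k
    _ = _ := by
        simp only [Finset.sum_const, Finset.card_univ, Fintype.card_fin, Finset.card_range, nsmul_eq_mul]
        rw [ENNReal.ofReal_mul (by positivity), ENNReal.ofReal_mul (by positivity), mul_assoc]
        congr 2
        · simp
        · have : ((m:ℝ) + n + 1) = ((m + n + 1 : ℕ) : ℝ) := by push_cast; rfl
          rw [this, ENNReal.ofReal_natCast]

lemma hc_finite {m n : ℕ} (x : Fin m → ℝ) (y : Fin n → ℝ) :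
    (Set.range fun t : ℝ => Real.sqrt (((m : ℝ) * n) / ((m : ℝ) + n)) * (empCDF x t - empCDF y t) /
    Real.sqrt (pooledCDF x y t * (1 - pooledCDF x y t))).Finite := by
  classical
  let g : Finset (Fin m) × Finset (Fin n) → ℝ := fun p =>
    Real.sqrt (((m : ℝ) * n) / ((m : ℝ) + n)) * ((p.1.card : ℝ) / m - (p.2.card : ℝ) / n) /
    Real.sqrt ((((m : ℝ) * ((p.1.card : ℝ) / m) + (n : ℝ) * ((p.2.card : ℝ) / n)) / ((m : ℝ) + n)) *
      (1 - (((m : ℝ) * ((p.1.card : ℝ) / m) + (n : ℝ) * ((p.2.card : ℝ) / n)) / ((m : ℝ) + n))))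
  refine (Set.finite_range g).subset ?_
  rintro _ ⟨t, rfl⟩
  exact ⟨(Finset.univ.filter fun i => x i ≤ t, Finset.univ.filter fun i => y i ≤ t), rfl⟩

lemma hc_emp {k : ℕ} (x : Fin k → ℝ) (t : ℝ) : empCDF x t = hcCount (· ≤ ·) x t / k := by
  classical
  simp [empCDF, hcCount, Set.indicator_apply]

lemma hc_mono (r : ℝ → ℝ → Prop) {k : ℕ} (x : Fin k → ℝ) (w z : ℝ)
    (h : ∀ i, r (x i) w → r (x i) z) : hcCount r x w ≤ hcCount r x z := by
  classical
  unfold hcCount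
  apply Finset.sum_le_sum
  intro i _
  by_cases h1 : r (x i) w
  · simp [h1, h i h1]
  · simp only [Set.indicator_apply, Set.mem_ofPred_eq, h1, if_false]; split_ifs <;> norm_num

lemma hc_congr (r s : ℝ → ℝ → Prop) {k : ℕ} (x : Fin k → ℝ) (w z : ℝ)
    (h : ∀ i, r (x i) w ↔ s (x i) z) : hcCount r x w = hcCount s x z := by
  classical
  unfold hcCount
  simp [Set.indicator_apply, h]

lemma hc_nonneg (r : ℝ → ℝ → Prop) {k : ℕ} (x : Fin k → ℝ) (z : ℝ) : 0 ≤ hcCount r x z := by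
  obtain ⟨c, _, h⟩ := hc_count_nat r x z
  rw [h]; positivity

lemma hc_exists (r : ℝ → ℝ → Prop) {k : ℕ} (x : Fin k → ℝ) (z : ℝ) (h : 0 < hcCount r x z) :
    ∃ i, r (x i) z := by
  classical
  by_contra hc
  push Not at hc
  simp [hcCount, Set.indicator_apply, hc] at h

lemma hc_compl (r s : ℝ → ℝ → Prop) {k : ℕ} (x : Fin k → ℝ) (z : ℝ)
    (h : ∀ w, s w z ↔ ¬ r w z) : hcCount s x z = k - hcCount r x z := by
  classical
  rw [eq_sub_iff_add_eq]
  unfold hcCount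
  rw [← Finset.sum_add_distrib]
  simp only [Set.indicator_apply, Set.mem_ofPred_eq, h]
  rw [Finset.sum_congr rfl (g := fun _ => (1:ℝ)) (fun i _ => by by_cases hh : r (x i) z <;> simp [hh])]
  simp

/-- Moving a bad point to a sample point. -/
lemma hc_move (r s : ℝ → ℝ → Prop) (v : ℝ) (hv : 0 ≤ v) {m n : ℕ} (x : Fin m → ℝ) (y : Fin n → ℝ)
    (z : ℝ) (j : Fin m) (hb : hcBad r v x y z) (hx : ∀ i, s (x i) (x j) ↔ r (x i) z)
    (hy : ∀ w, s w (x j) → r w z) : hcBad s v x y (x j) := by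
  classical
  obtain ⟨h1, h2⟩ := hb
  have e1 : hcCount s x (x j) = hcCount r x z := hc_congr s r x _ _ hx
  have e2 : hcCount s y (x j) ≤ hcCount r y z := by
    unfold hcCount
    apply Finset.sum_le_sum
    intro i _
    by_cases h1 : s (y i) (x j)
    · simp [h1, hy _ h1]
    · simp only [Set.indicator_apply, Set.mem_ofPred_eq, h1, if_false]; split_ifs <;> norm_num
  have e3 : (n:ℝ) * hcCount r x z - m * hcCount r y z ≤ n * hcCount s x (x j) - m * hcCount s y (x j) := by
    rw [e1]; gcongr
  refine ⟨h1.trans_le e3, ?_⟩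
  calc _ ≤ v * (hcCount r x z + hcCount r y z) * (m + n) ^ 2 := by rw [e1]; gcongr
    _ ≤ _ := h2
    _ ≤ _ := by gcongr

set_option maxHeartbeats 1000000 in
lemma hc_det {m n : ℕ} (x : Fin m → ℝ) (y : Fin n → ℝ) (hn : 0 < n) (hnm : n ≤ m) (η L : ℝ)
    (hη : 0 < η) (hηn : η * (m + n) ≤ 2 * n) (hL : 0 < L) (h : L ≤ HCstat x y) :
    (∃ j, hcBad (· ≤ ·) (η / 8 * L ^ 2) x y (x j)) ∨
    (∃ j, hcBad (· ≥ ·) (η / 8 * L ^ 2) y x (y j)) := by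
  obtain ⟨t, ht⟩ := (Set.range_nonempty _).csSup_mem (hc_finite x y)
  have ht2 : L ≤ Real.sqrt (((m : ℝ) * n) / ((m : ℝ) + n)) * (empCDF x t - empCDF y t) /
    Real.sqrt (pooledCDF x y t * (1 - pooledCDF x y t)) := by
    simp only at ht
    rw [ht]; exact h
  clear ht h
  have hm : 0 < m := by omega
  have hmR : (0:ℝ) < m := by exact_mod_cast hm
  have hnR : (0:ℝ) < n := by exact_mod_cast hn
  have hnmR : (n:ℝ) ≤ m := by exact_mod_cast hnm
  set A := hcCount (· ≤ ·) x t with hA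
  set B := hcCount (· ≤ ·) y t with hB
  have hpool : pooledCDF x y t = (A + B) / (m + n) := by
    unfold pooledCDF
    rw [hc_emp, hc_emp, ← hA, ← hB]; field_simp
  rw [hpool, hc_emp, hc_emp, ← hA, ← hB] at ht2
  set h := (A + B) / ((m:ℝ) + n) with hh
  set D := A / m - B / n with hD
  have hA0 : 0 ≤ A := hc_nonneg _ _ _
  have hB0 : 0 ≤ B := hc_nonneg _ _ _
  have hden : 0 < Real.sqrt (h * (1 - h)) := by
    rcases (Real.sqrt_nonneg (h * (1 - h))).lt_or_eq with h0 | h0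
    · exact h0
    · rw [← h0, div_zero] at ht2; linarith
  have hhh : 0 < h * (1 - h) := Real.sqrt_pos.mp hden
  rw [le_div_iff₀ hden] at ht2
  have hLs : 0 < L * Real.sqrt (h * (1 - h)) := by positivity
  have hDp : 0 < D := by
    by_contra hc
    push Not at hc
    have := mul_nonpos_of_nonneg_of_nonpos (Real.sqrt_nonneg (((m : ℝ) * n) / ((m : ℝ) + n))) hc
    linarith
  have hsq := pow_le_pow_left₀ hLs.le ht2 2
  rw [mul_pow, mul_pow, Real.sq_sqrt hhh.le, Real.sq_sqrt (by positivity)] at hsq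
  have hDe : D = (n * A - m * B) / (m * n) := by rw [hD]; field_simp
  set S := n * A - m * B with hS
  have hSp : 0 < S := by
    have : S = D * (m * n) := by rw [hDe]; field_simp
    rw [this]; positivity
  have hN : (0:ℝ) < m + n := by positivity
  -- S^2 bound
  have hS2 : L ^ 2 * (m * n) * ((A + B) * (m + n - (A + B))) ≤ S ^ 2 * (m + n) := by
    have e1 : L ^ 2 * (h * (1 - h)) = L ^ 2 * ((A + B) * (m + n - (A + B))) / (m + n) ^ 2 := by
      rw [hh]; field_simp
    have e2 : (m * n : ℝ) / (m + n) * D ^ 2 = S ^ 2 / ((m + n) * (m * n)) := by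
      rw [hDe]; field_simp
    rw [e1, e2, div_le_div_iff₀ (by positivity) (by positivity)] at hsq
    have : (L ^ 2 * (m * n) * ((A + B) * (m + n - (A + B)))) * (m + n) ≤ (S ^ 2 * (m + n)) * (m + n) := by
      nlinarith [hsq]
    exact le_of_mul_le_mul_right this hN
  have hh1 : 0 < h ∧ h < 1 := by
    rcases mul_pos_iff.mp hhh with ⟨a, b⟩ | ⟨a, b⟩
    · exact ⟨a, by linarith⟩
    · exfalso; linarith
  have hk0 : 0 < A + B := by
    have := hh1.1; rw [hh] at this
    exact (div_pos_iff_of_pos_right hN).mp this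
  have hk1 : A + B < m + n := by
    have := hh1.2; rw [hh, div_lt_one hN] at this; exact this
  have hmn8 : η / 4 * (m + n) ^ 2 ≤ m * n := by nlinarith
  have hgen : ∀ k : ℝ, 0 ≤ k → k * (m + n) / 2 ≤ (A + B) * (m + n - (A + B)) →
      η / 8 * L ^ 2 * k * (m + n) ^ 2 ≤ S ^ 2 := by
    intro k hk hk2
    have : (η / 8 * L ^ 2 * k * (m + n) ^ 2) * (m + n) ≤ S ^ 2 * (m + n) := by
      calc _ = L ^ 2 * (η / 4 * (m + n) ^ 2) * (k * (m + n) / 2) := by ring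
        _ ≤ L ^ 2 * (m * n) * ((A + B) * (m + n - (A + B))) := by gcongr
        _ ≤ _ := hS2
    exact le_of_mul_le_mul_right this hN
  have hv : 0 ≤ η / 8 * L ^ 2 := by positivity
  rcases le_total (2 * (A + B)) (m + n) with hc | hc
  · left
    have hbad : hcBad (· ≤ ·) (η / 8 * L ^ 2) x y t := by
      refine ⟨hSp, hgen _ hk0.le ?_⟩
      have := mul_nonneg hk0.le (sub_nonneg.mpr hc)
      linarith
    have hAp : 0 < A := by
      by_contra hneg
      have : A = 0 := le_antisymm (not_lt.mp hneg) hA0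
      rw [hS, this] at hSp
      have := mul_nonneg hmR.le hB0
      linarith
    obtain ⟨i0, hi0⟩ := hc_exists _ x t hAp
    obtain ⟨j, hj, hjm⟩ := Finset.exists_max_image (Finset.univ.filter fun i => x i ≤ t) x
      ⟨i0, by simpa using hi0⟩
    simp only [Finset.mem_filter, Finset.mem_univ, true_and] at hj hjm
    exact ⟨j, hc_move _ _ _ hv x y t j hbad (fun i => ⟨fun h => h.trans hj, fun h => hjm i h⟩)
      (fun w h => h.trans hj)⟩
  · right
    have eA : hcCount (· > ·) x t = m - A := hc_compl _ _ x t (fun w => not_le.symm)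
    have eB : hcCount (· > ·) y t = n - B := hc_compl _ _ y t (fun w => not_le.symm)
    have eS : (m:ℝ) * (n - B) - n * (m - A) = S := by rw [hS]; ring
    have hbad : hcBad (· > ·) (η / 8 * L ^ 2) y x t := by
      unfold hcBad
      rw [eA, eB, eS]
      refine ⟨hSp, ?_⟩
      have h9 := mul_nonneg (sub_nonneg.mpr hk1.le) (sub_nonneg.mpr hc)
      have := hgen (m + n - (A + B)) (by linarith) (by linarith)
      convert this using 1; ring
    have hBp : 0 < hcCount (· > ·) y t := by
      have hA1 : 0 ≤ (m:ℝ) - A := eA ▸ hc_nonneg _ _ _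
      have hB1 : 0 ≤ (n:ℝ) - B := eB ▸ hc_nonneg _ _ _
      rw [eB]
      by_contra hneg
      have : (n:ℝ) - B = 0 := le_antisymm (not_lt.mp hneg) hB1
      rw [← eS, this] at hSp
      have := mul_nonneg hnR.le hA1
      linarith
    obtain ⟨i0, hi0⟩ := hc_exists _ y t hBp
    obtain ⟨j, hj, hjm⟩ := Finset.exists_min_image (Finset.univ.filter fun i => y i > t) y
      ⟨i0, by simpa using hi0⟩
    simp only [Finset.mem_filter, Finset.mem_univ, true_and] at hj hjm
    exact ⟨j, hc_move _ _ _ hv y x t j hbad (fun i => ⟨fun h => lt_of_lt_of_le hj h, fun h => hjm i h⟩)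
      (fun w h => lt_of_lt_of_le hj h)⟩

lemma hc_type1_bound (P : Measure ℝ) [IsProbabilityMeasure P] (m n : ℕ) (hn : 0 < n) (hnm : n ≤ m)
    (η L : ℝ) (hη : 0 < η) (hηn : η * (m + n) ≤ 2 * n) (hL : 0 < L) :
    (((Measure.pi fun _ : Fin m => P).prod (Measure.pi fun _ : Fin n => P))
      {ω | L ≤ HCstat ω.1 ω.2}).toReal ≤
      (m + n) * (m + n + 1) * Real.exp (2 - η / 8 * L ^ 2 / 4) := by
  have hv : 0 < η / 8 * L ^ 2 := by positivity
  have b1 := hc_bad_prob P (· ≤ ·) measurableSet_le' m n _ hv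
  have b2 := hc_bad_prob P (· ≥ ·) (measurableSet_le measurable_snd measurable_fst) n m _ hv
  set e := Real.exp (2 - η / 8 * L ^ 2 / 4) with he
  have hsub : {ω : (Fin m → ℝ) × (Fin n → ℝ) | L ≤ HCstat ω.1 ω.2} ⊆
      {ω | ∃ j, hcBad (· ≤ ·) (η / 8 * L ^ 2) ω.1 ω.2 (ω.1 j)} ∪
      (MeasurableEquiv.prodComm ⁻¹' {ω : (Fin n → ℝ) × (Fin m → ℝ) | ∃ j, hcBad (· ≥ ·) (η / 8 * L ^ 2) ω.1 ω.2 (ω.1 j)}) := by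
    rintro ⟨x, y⟩ h
    exact hc_det x y hn hnm η L hη hηn hL h
  have hswap : MeasurePreserving (MeasurableEquiv.prodComm : ((Fin m → ℝ) × (Fin n → ℝ)) ≃ᵐ _)
    ((Measure.pi fun _ : Fin m => P).prod (Measure.pi fun _ : Fin n => P))
    ((Measure.pi fun _ : Fin n => P).prod (Measure.pi fun _ : Fin m => P)) :=
    Measure.measurePreserving_swap
  apply ENNReal.toReal_le_of_le_ofReal (by positivity)
  refine (measure_mono hsub).trans ((measure_union_le _ _).trans ?_)
  rw [hswap.measure_preimage_equiv]
  refine (add_le_add b1 b2).trans ?_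
  rw [← ENNReal.ofReal_add (by positivity) (by positivity)]
  apply ENNReal.ofReal_le_ofReal
  apply le_of_eq
  ring

lemma hc_type1_lim (η : ℝ) (hη : 0 < η) :
    Tendsto (fun n : ℕ => 8 / η ^ 2 * Real.exp (Real.log n * (2 - η / 32 * Real.log n) + 2)) atTop (𝓝 0) := by
  have hlog : Tendsto (fun n : ℕ => Real.log n) atTop atTop :=
    Real.tendsto_log_atTop.comp tendsto_natCast_atTop_atTop
  have h1 : Tendsto (fun n : ℕ => 2 - η / 32 * Real.log n) atTop atBot := by
    have := (hlog.const_mul_atTop (show 0 < η / 32 by positivity))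
    simpa [sub_eq_add_neg] using tendsto_atBot_add_const_left _ 2 (tendsto_neg_atTop_atBot.comp this)
  have h2 := tendsto_atBot_add_const_right _ (2:ℝ) (hlog.atTop_mul_atBot₀ h1)
  simpa using (Real.tendsto_exp_atBot.comp h2).const_mul (8 / η ^ 2)

lemma hc_cheb (κ : Measure ℝ) [IsProbabilityMeasure κ] (k : ℕ) (hk : 0 < k) (t a : ℝ) (ha : 0 < a) :
    (Measure.pi fun _ : Fin k => κ) {x | a ≤ |empCDF x t - (κ (Set.Iic t)).toReal|} ≤
      ENNReal.ofReal ((1 - (κ (Set.Iic t)).toReal) / (k * a ^ 2)) := by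
  set q := (κ (Set.Iic t)).toReal with hq
  have hq0 : 0 ≤ q := ENNReal.toReal_nonneg
  have hq1 : q ≤ 1 := measureReal_le_one
  have hkR : (0:ℝ) < k := by exact_mod_cast hk
  set f : ℝ → ℝ := (Set.Iic t).indicator (fun _ => (1:ℝ)) with hf
  have hfm : Measurable f := measurable_const.indicator measurableSet_Iic
  have hfL : MemLp f 2 κ := memLp_indicator_const _ measurableSet_Iic _ (Or.inr (by finiteness))
  have hfi : ∫ x, f x ∂κ = q := by
    rw [hf, integral_indicator_const _ measurableSet_Iic]; simp [hq, measureReal_def]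
  have hfv : Var[f; κ] ≤ 1 - q := by
    rw [variance_eq_sub hfL]
    have : f ^ 2 = f := by
      ext x; by_cases h : x ∈ Set.Iic t <;> simp [hf, h]
    rw [this, hfi]
    nlinarith
  set X : (Fin k → ℝ) → ℝ := ∑ i : Fin k, fun x => f (x i) with hX
  have hXL : MemLp X 2 (Measure.pi fun _ : Fin k => κ) :=
    memLp_finsetSum' _ fun i _ => hfL.comp_measurePreserving (measurePreserving_eval _ i)
  have hXv : Var[X; Measure.pi fun _ : Fin k => κ] ≤ k * (1 - q) := by
    rw [hX, variance_sum_pi (X := fun _ => f) (fun _ => hfL)]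
    simp only [Finset.sum_const, Finset.card_univ, Fintype.card_fin, nsmul_eq_mul]
    gcongr
  have hXi : ∫ x, X x ∂(Measure.pi fun _ : Fin k => κ) = k * q := by
    have : ∀ x, X x = ∑ i, f (x i) := fun x => by simp [hX]
    simp_rw [this]
    rw [integral_finsetSum _ fun i _ => integrable_comp_eval (hfL.integrable (by norm_num))]
    have : ∀ i : Fin k, ∫ x : Fin k → ℝ, f (x i) ∂(Measure.pi fun _ : Fin k => κ) = q := fun i => by
      rw [integral_comp_eval (μ := fun _ : Fin k => κ) hfm.aestronglyMeasurable, hfi]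
    simp [this]
  have hemp : ∀ x : Fin k → ℝ, empCDF x t = X x / k := by
    intro x
    rw [hc_emp]
    simp only [hX, hcCount, Finset.sum_apply]
    rfl
  have hset : {x : Fin k → ℝ | a ≤ |empCDF x t - q|} ⊆
      {x | k * a ≤ |X x - ∫ x, X x ∂(Measure.pi fun _ : Fin k => κ)|} := by
    intro x hx
    simp only [Set.mem_ofPred_eq] at hx ⊢
    rw [hXi]
    rw [hemp] at hx
    have : X x - k * q = k * (X x / k - q) := by field_simp
    rw [this, abs_mul, abs_of_pos hkR]
    gcongr
  refine (measure_mono hset).trans ((meas_ge_le_variance_div_sq hXL (by positivity)).trans ?_)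
  apply ENNReal.ofReal_le_ofReal
  calc _ ≤ (k * (1 - q)) / (k * a) ^ 2 := by gcongr
    _ = _ := by field_simp

lemma hc_stat_ge {m n : ℕ} (x : Fin m → ℝ) (y : Fin n → ℝ) (hn : 0 < n) (hnm : n ≤ m)
    (t δ C L : ℝ) (hδ : 0 < δ) (hC : 0 < C) (hD : δ ≤ empCDF x t - empCDF y t)
    (hH : 1 - pooledCDF x y t ≤ C) (hL : L * Real.sqrt (2 * C) ≤ Real.sqrt n * δ) :
    L ≤ HCstat x y := by
  refine le_trans ?_ (le_ciSup (hc_finite x y).bddAbove t)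
  have hm : 0 < m := by omega
  have hmR : (0:ℝ) < m := by exact_mod_cast hm
  have hnR : (0:ℝ) < n := by exact_mod_cast hn
  have hnmR : (n:ℝ) ≤ m := by exact_mod_cast hnm
  set A := hcCount (· ≤ ·) x t with hA
  set B := hcCount (· ≤ ·) y t with hB
  have hpool : pooledCDF x y t = (A + B) / (m + n) := by
    unfold pooledCDF
    rw [hc_emp, hc_emp, ← hA, ← hB]; field_simp
  have hA0 : 0 ≤ A := hc_nonneg _ _ _
  have hB0 : 0 ≤ B := hc_nonneg _ _ _
  have hA1 : 0 ≤ (m:ℝ) - A := (hc_compl (· ≤ ·) (· > ·) x t (fun w => not_le.symm)) ▸ hc_nonneg _ _ _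
  have hB1 : 0 ≤ (n:ℝ) - B := (hc_compl (· ≤ ·) (· > ·) y t (fun w => not_le.symm)) ▸ hc_nonneg _ _ _
  have hpos : 0 < A / m - B / n := by
    rw [hc_emp, hc_emp] at hD; linarith
  have hAp : 0 < A := by
    rcases hA0.lt_or_eq with h | h
    · exact h
    · rw [← h] at hpos
      have : 0 ≤ B / n := by positivity
      simp at hpos; linarith
  have hBp : B < n := by
    by_contra h
    have h' : B = n := le_antisymm (by linarith) (not_lt.mp h)
    rw [h', div_self hnR.ne'] at hpos
    have : A / m ≤ 1 := (div_le_one hmR).mpr (by linarith)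
    linarith
  set h := pooledCDF x y t with hh
  have hN : (0:ℝ) < m + n := by positivity
  have h0 : 0 < h := by rw [hpool]; positivity
  have h1 : h < 1 := by rw [hpool, div_lt_one hN]; linarith
  have hhp : 0 < h * (1 - h) := mul_pos h0 (by linarith)
  have hhC : h * (1 - h) ≤ C := by nlinarith
  rw [le_div_iff₀ (Real.sqrt_pos.mpr hhp)]
  have hmn : (n:ℝ) / 2 ≤ m * n / (m + n) := by
    rw [div_le_div_iff₀ (by norm_num) hN]; nlinarith
  rcases le_or_gt L 0 with hL0 | hL0
  · have a1 : L * Real.sqrt (h * (1 - h)) ≤ 0 := mul_nonpos_of_nonpos_of_nonneg hL0 (Real.sqrt_nonneg _)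
    have a2 : 0 ≤ Real.sqrt (((m : ℝ) * n) / ((m : ℝ) + n)) * (empCDF x t - empCDF y t) :=
      mul_nonneg (Real.sqrt_nonneg _) (by linarith)
    linarith
  calc L * Real.sqrt (h * (1 - h)) ≤ L * Real.sqrt C := by gcongr
    _ = L * Real.sqrt (2 * C) / Real.sqrt 2 := by
        rw [Real.sqrt_mul (by norm_num)]; field_simp
    _ ≤ Real.sqrt n * δ / Real.sqrt 2 := by gcongr
    _ = Real.sqrt (n / 2) * δ := by rw [Real.sqrt_div' _ (by norm_num)]; ring
    _ ≤ _ := by gcongr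

lemma hc_power_bound (P Q : Measure ℝ) [IsProbabilityMeasure P] [IsProbabilityMeasure Q] (m n : ℕ)
    (hn : 0 < n) (hnm : n ≤ m) (t δ C L : ℝ) (hδ : 0 < δ) (hC : 0 < C)
    (hD : (P (Set.Iic t)).toReal - (Q (Set.Iic t)).toReal = δ)
    (hH : (m * (1 - (P (Set.Iic t)).toReal) + n * (1 - (Q (Set.Iic t)).toReal)) / (m + n) + δ / 4 ≤ C)
    (hL : L * Real.sqrt (2 * C) ≤ Real.sqrt n * (δ / 2)) :
    1 - 16 * ((1 - (P (Set.Iic t)).toReal) + (1 - (Q (Set.Iic t)).toReal)) / (n * δ ^ 2) ≤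
    (((Measure.pi fun _ : Fin m => P).prod (Measure.pi fun _ : Fin n => Q))
      {ω | L ≤ HCstat ω.1 ω.2}).toReal := by
  have hm : 0 < m := by omega
  have hmR : (0:ℝ) < m := by exact_mod_cast hm
  have hnR : (0:ℝ) < n := by exact_mod_cast hn
  have hnmR : (n:ℝ) ≤ m := by exact_mod_cast hnm
  have c1 := hc_cheb P m hm t (δ/4) (by positivity)
  have c2 := hc_cheb Q n hn t (δ/4) (by positivity)
  have hp1 : (P (Set.Iic t)).toReal ≤ 1 := measureReal_le_one
  have hq1 : (Q (Set.Iic t)).toReal ≤ 1 := measureReal_le_one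
  set p := (P (Set.Iic t)).toReal with hp
  set q := (Q (Set.Iic t)).toReal with hq
  set U := {x : Fin m → ℝ | δ/4 ≤ |empCDF x t - p|} with hU
  set V := {y : Fin n → ℝ | δ/4 ≤ |empCDF y t - q|} with hV
  set M := ((Measure.pi fun _ : Fin m => P).prod (Measure.pi fun _ : Fin n => Q)) with hM
  set S := {ω : (Fin m → ℝ) × (Fin n → ℝ) | L ≤ HCstat ω.1 ω.2} with hS
  have hcover : (Set.univ : Set ((Fin m → ℝ) × (Fin n → ℝ))) ⊆ S ∪ ((U ×ˢ Set.univ) ∪ (Set.univ ×ˢ V)) := by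
    rintro ⟨x, y⟩ -
    by_cases hx : x ∈ U
    · right; left; exact ⟨hx, trivial⟩
    by_cases hy : y ∈ V
    · right; right; exact ⟨trivial, hy⟩
    left
    simp only [hU, hV, Set.mem_ofPred_eq, not_le, abs_lt] at hx hy
    refine hc_stat_ge x y hn hnm t (δ/2) C L (by positivity) hC (by linarith) ?_ hL
    refine le_trans ?_ hH
    unfold pooledCDF
    have hN : (0:ℝ) < m + n := by positivity
    rw [← sub_nonneg]
    have : (m * (1 - p) + n * (1 - q)) / (m + n) + δ / 4 -
        (1 - (m * empCDF x t + n * empCDF y t) / (m + n)) =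
        (m * (empCDF x t - p + δ/4) + n * (empCDF y t - q + δ / 4)) / (m + n) := by
      field_simp; ring
    rw [this]
    have i1 : 0 ≤ empCDF x t - p + δ/4 := by linarith
    have i2 : 0 ≤ empCDF y t - q + δ/4 := by linarith
    positivity
  have hle : (1 : ENNReal) ≤ M S + ENNReal.ofReal (16 * ((1 - p) + (1 - q)) / (n * δ ^ 2)) := by
    calc (1:ENNReal) = M Set.univ := by simp
      _ ≤ M S + (M (U ×ˢ Set.univ) + M (Set.univ ×ˢ V)) :=
        (measure_mono hcover).trans ((measure_union_le _ _).trans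
          (by gcongr; exact measure_union_le _ _))
      _ ≤ M S + (ENNReal.ofReal ((1 - p) / (m * (δ/4) ^ 2)) + ENNReal.ofReal ((1 - q) / (n * (δ/4) ^ 2))) := by
        rw [hM, Measure.prod_prod, Measure.prod_prod]
        simp only [measure_univ, mul_one, one_mul]
        gcongr
      _ ≤ _ := by
        rw [← ENNReal.ofReal_add (div_nonneg (by linarith) (by positivity)) (div_nonneg (by linarith) (by positivity))]
        gcongr
        have : (1 - p) / (m * (δ/4) ^ 2) ≤ (1 - p) / (n * (δ/4) ^ 2) := by
          apply div_le_div_of_nonneg_left (by linarith) (by positivity)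
          gcongr
        refine (add_le_add_left this _).trans (le_of_eq ?_)
        field_simp; ring
  have := ENNReal.toReal_mono (by finiteness) hle
  rw [ENNReal.toReal_add (by finiteness) (by finiteness), ENNReal.toReal_ofReal] at this
  · simp at this; linarith
  · apply div_nonneg _ (by positivity); linarith

end HCproof

set_option maxHeartbeats 1000000 in
/-- In the two-sample problem, if there is a sequence t_n → ∞ with
`n·max(F̄(t_n), ε_n F̄(t_n−μ_n))/(log n)² → ∞` and
`√n ε_n (F̄(t_n−μ_n) − F̄(t_n)) / (√(F̄(t_n) + ε_n η F̄(t_n−μ_n)) log n) → ∞`,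
then the two-sample higher criticism test rejecting when HC ≥ log n is
asymptotically powerful: its type I error under H0 tends to 0 and its power
under H1 tends to 1. -/
theorem stmt_0
    (P : Measure ℝ) [IsProbabilityMeasure P]
    (F : ℝ → ℝ) (hF : ∀ t, F t = (P (Set.Iic t)).toReal) (hFcont : Continuous F)
    (ε μ : ℕ → ℝ) (hε : ∀ n, ε n ∈ Set.Ioo (0:ℝ) (1/2)) (hμ : ∀ n, 0 < μ n)
    (η : ℝ) (hη : η ∈ Set.Ioc (0:ℝ) (1/2))
    (m : ℕ → ℕ) (hmn : ∀ᶠ n in atTop, n ≤ m n)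
    (hcouple : (fun n : ℕ => (n : ℝ) / ((m n : ℝ) + n) - η)
      =O[atTop] fun n => Real.log n / Real.sqrt n)
    (Q : ℕ → Measure ℝ) [∀ n, IsProbabilityMeasure (Q n)]
    (hQ : ∀ n, Q n = ENNReal.ofReal (1 - ε n) • P + ENNReal.ofReal (ε n) • P.map (· + μ n))
    (t : ℕ → ℝ) (ht : Tendsto t atTop atTop)
    (h1 : Tendsto (fun n : ℕ => (n : ℝ) * max (1 - F (t n)) (ε n * (1 - F (t n - μ n))) /
      (Real.log n) ^ 2) atTop atTop)
    (h2 : Tendsto (fun n : ℕ => Real.sqrt n * ε n * ((1 - F (t n - μ n)) - (1 - F (t n))) /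
      (Real.sqrt ((1 - F (t n)) + ε n * η * (1 - F (t n - μ n))) * Real.log n))
      atTop atTop) :
    Tendsto (fun n => (((Measure.pi fun _ : Fin (m n) => P).prod
        (Measure.pi fun _ : Fin n => P))
        {ω | Real.log n ≤ HCstat ω.1 ω.2}).toReal) atTop (𝓝 0) ∧
    Tendsto (fun n => (((Measure.pi fun _ : Fin (m n) => P).prod
        (Measure.pi fun _ : Fin n => Q n))
        {ω | Real.log n ≤ HCstat ω.1 ω.2}).toReal) atTop (𝓝 1) := by
  obtain ⟨hη0, hη1⟩ := hη
  have hlog : Tendsto (fun n : ℕ => Real.log n) atTop atTop :=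
    Real.tendsto_log_atTop.comp tendsto_natCast_atTop_atTop
  have hrate : Tendsto (fun n : ℕ => Real.log n / Real.sqrt n) atTop (𝓝 0) := by
    have := (isLittleO_log_rpow_atTop (show (0:ℝ) < 1/2 by norm_num)).tendsto_div_nhds_zero
    have := this.comp tendsto_natCast_atTop_atTop
    refine this.congr fun n => ?_
    simp [Real.sqrt_eq_rpow]
  have hlim := hcouple.trans_tendsto hrate
  have hclose : ∀ᶠ n : ℕ in atTop, |(n : ℝ) / ((m n : ℝ) + n) - η| < η / 2 := by
    have := (tendsto_order.1 hlim.abs).2 (η/2) (by simpa using hη0)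
    exact this
  have hbasic : ∀ᶠ n : ℕ in atTop, 0 < n ∧ n ≤ m n ∧ 1 ≤ Real.log n ∧ η * (m n + n) ≤ 2 * n ∧
      (n:ℝ) / (m n + n) ≤ 2 * η := by
    filter_upwards [eventually_gt_atTop 0, hmn, hlog.eventually_ge_atTop 1, hclose] with n a b c d
    have hnR : (0:ℝ) < n := by exact_mod_cast a
    rw [abs_lt] at d
    refine ⟨a, b, c, ?_, by linarith⟩
    have : η / 2 ≤ (n : ℝ) / ((m n : ℝ) + n) := by linarith
    rw [le_div_iff₀ (by positivity)] at this
    linarith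
  constructor
  · refine tendsto_of_tendsto_of_tendsto_of_le_of_le' tendsto_const_nhds (hc_type1_lim η hη0)
      (Eventually.of_forall fun n => ENNReal.toReal_nonneg) ?_
    filter_upwards [hbasic] with n ⟨a, b, c, d, e⟩
    refine (hc_type1_bound P (m n) n a b η (Real.log n) hη0 d (by linarith)).trans ?_
    have hnR : (1:ℝ) ≤ n := by exact_mod_cast a
    have hN : (m n + n : ℝ) ≤ 2 / η * n := by
      rw [div_mul_eq_mul_div, le_div_iff₀ hη0]; linarith
    have hN1 : (m n + n + 1 : ℝ) ≤ 2 * (2 / η * n) := by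
      have : (0:ℝ) ≤ m n := by positivity
      linarith
    calc _ ≤ (2 / η * n) * (2 * (2 / η * n)) * Real.exp (2 - η / 8 * Real.log n ^ 2 / 4) := by gcongr
      _ = 8 / η ^ 2 * (n ^ 2 * Real.exp (2 - η / 8 * Real.log n ^ 2 / 4)) := by field_simp; ring
      _ = _ := by
        congr 1
        conv_lhs => rw [← Real.exp_log (show (0:ℝ) < n by linarith)]
        rw [Real.exp_log (show (0:ℝ) < n by linarith)]
        rw [← Real.exp_log (show (0:ℝ) < n ^ 2 by positivity), ← Real.exp_add, Real.log_pow]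
        congr 1
        push_cast; ring
  · set R : ℕ → ℝ := fun n : ℕ => Real.sqrt n * ε n * ((1 - F (t n - μ n)) - (1 - F (t n))) /
      (Real.sqrt ((1 - F (t n)) + ε n * η * (1 - F (t n - μ n))) * Real.log n) with hR
    set K : ℝ := 2 + 1 / (4 * η) with hK
    have hK0 : 0 < K := by positivity
    have hlow : Tendsto (fun n => 1 - 16 / η * (R n ^ 2)⁻¹) atTop (𝓝 1) := by
      have : Tendsto (fun n => R n ^ 2) atTop atTop := (tendsto_pow_atTop (by norm_num)).comp h2
      have := (tendsto_inv_atTop_zero.comp this).const_mul (16 / η)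
      simpa using this.const_sub 1
    refine tendsto_of_tendsto_of_tendsto_of_le_of_le' hlow tendsto_const_nhds ?_
      (Eventually.of_forall fun n => measureReal_le_one)
    filter_upwards [hbasic, h2.eventually_ge_atTop (2 * Real.sqrt (2 * K)), h2.eventually_gt_atTop 0]
      with n ⟨a, b, c, d, e⟩ hR1 hR0
    have hnR : (0:ℝ) < n := by exact_mod_cast a
    obtain ⟨he0, he1⟩ := hε n
    have hFle : ∀ s, F s ≤ 1 := fun s => by rw [hF]; exact measureReal_le_one
    have hQF : (Q n (Set.Iic (t n))).toReal = (1 - ε n) * F (t n) + ε n * F (t n - μ n) := by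
      rw [hQ, hF, hF, Measure.add_apply, Measure.smul_apply, Measure.smul_apply,
        Measure.map_apply (by fun_prop) measurableSet_Iic]
      have : (fun x : ℝ => x + μ n) ⁻¹' Set.Iic (t n) = Set.Iic (t n - μ n) := by
        ext x; simp [le_sub_iff_add_le]
      rw [this, smul_eq_mul, smul_eq_mul, ENNReal.toReal_add (by finiteness) (by finiteness),
        ENNReal.toReal_mul, ENNReal.toReal_mul, ENNReal.toReal_ofReal (by linarith),
        ENNReal.toReal_ofReal he0.le]
    set p := 1 - F (t n) with hp
    set q := 1 - F (t n - μ n) with hq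
    have hp0 : 0 ≤ p := by linarith [hFle (t n)]
    have hq0 : 0 ≤ q := by linarith [hFle (t n - μ n)]
    set w := p + ε n * η * q with hw
    set L := Real.log n with hLdef
    set δ := ε n * (q - p) with hδ
    have hRn : R n = Real.sqrt n * δ / (Real.sqrt w * L) := by
      simp only [hR]; rw [hδ, mul_assoc]
    have hRn0 : 0 < R n := hR0
    have hRn1 : 2 * Real.sqrt (2 * K) ≤ R n := hR1
    have hL0 : 0 < L := by linarith
    have hw0 : 0 < w := by
      rcases (show 0 ≤ w by positivity).lt_or_eq with h | h
      · exact h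
      · rw [hRn, ← h] at hRn0; simp at hRn0
    have hsw : 0 < Real.sqrt w := Real.sqrt_pos.mpr hw0
    have hsn : 0 < Real.sqrt n := Real.sqrt_pos.mpr hnR
    have hmul : Real.sqrt n * δ = R n * (Real.sqrt w * L) := by
      rw [hRn]; field_simp
    have hδ0 : 0 < δ := by
      have : 0 < Real.sqrt n * δ := by rw [hmul]; positivity
      exact (mul_pos_iff_of_pos_left hsn).mp this
    have hεq : ε n * q ≤ w / η := by
      rw [le_div_iff₀ hη0, hw]; nlinarith
    have hδw : δ ≤ w / η := by
      refine le_trans ?_ hεq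
      rw [hδ]; nlinarith
    have hPt : (P (Set.Iic (t n))).toReal = 1 - p := by rw [← hF, hp]; ring
    have hQt : (Q n (Set.Iic (t n))).toReal = 1 - p - δ := by rw [hQF, hδ, hp, hq]; ring
    have hN : (0:ℝ) < m n + n := by positivity
    have hmain := hc_power_bound P (Q n) (m n) n a b (t n) δ (K * w) L hδ0 (by positivity)
      (by rw [hPt, hQt]; ring) (by
        rw [hPt, hQt]
        have e1 : (m n * (1 - (1 - p)) + n * (1 - (1 - p - δ))) / (m n + n) = p + n / (m n + n) * δ := by
          field_simp; ring
        rw [e1]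
        have e2 : n / (m n + n) * δ ≤ 2 * η * (ε n * q) := by
          have : δ ≤ ε n * q := by rw [hδ]; nlinarith
          gcongr
        have e3 : K * w = 2 * w + (w / η) / 4 := by rw [hK]; field_simp
        rw [e3, hw]
        rw [hw] at hδw
        linarith) (by
        rw [show 2 * (K * w) = (2 * K) * w by ring, Real.sqrt_mul (by positivity)]
        have := mul_le_mul_of_nonneg_right hRn1 (show 0 ≤ Real.sqrt w * L by positivity)
        rw [← hmul] at this
        linarith)
    refine le_trans ?_ hmain
    rw [hPt, hQt]
    have g1 : (1 - (1 - p)) + (1 - (1 - p - δ)) ≤ w / η := by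
      have e1 : (1 - (1 - p)) + (1 - (1 - p - δ)) ≤ 2 * p + ε n * q := by
        rw [hδ]; nlinarith
      refine e1.trans ?_
      rw [le_div_iff₀ hη0, hw]
      nlinarith
    have g2 : n * δ ^ 2 = R n ^ 2 * (w * L ^ 2) := by
      have h5 : (Real.sqrt n * δ) ^ 2 = (R n * (Real.sqrt w * L)) ^ 2 := by rw [hmul]
      rw [mul_pow _ δ, mul_pow (R n), mul_pow _ L, Real.sq_sqrt hnR.le, Real.sq_sqrt hw0.le] at h5
      exact h5
    have g3 : 16 * ((1 - (1 - p)) + (1 - (1 - p - δ))) / (n * δ ^ 2) ≤ 16 / η * (R n ^ 2)⁻¹ := by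
      calc _ ≤ 16 * (w / η) / (n * δ ^ 2) := by gcongr
        _ = 16 / η * (R n ^ 2)⁻¹ * (L ^ 2)⁻¹ := by rw [g2]; field_simp
        _ ≤ 16 / η * (R n ^ 2)⁻¹ * 1 := by
          gcongr
          exact inv_le_one_of_one_le₀ (one_le_pow₀ c)
        _ = _ := by ring
    linarith
end

section
/- Consider the two-sample testing problem with alternative parameters ε = ε_n ∈ (0,1/2) and μ = μ_n > 0 possibly varying with n. Let t be the median of F, i.e., F(t) = 1/2. If √n ε_n (\bar F(t − μ_n) − 1/2) / log n → ∞, then the two-sample higher criticism test that rejects when HC ≥ log n is asymptotically powerful: its type I error probability under H0 tends to 0 and its power under H1 tends to 1 as n → ∞. -/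
open MeasureTheory ProbabilityTheory Filter Set Topology

lemma exp_le_add_exp_sq (u : ℝ) : Real.exp u ≤ u + Real.exp (u^2) := by
  have h1 := Real.add_one_le_exp (u^2)
  rcases le_or_gt |u| 1 with h | h
  · have := (abs_le.1 (Real.abs_exp_sub_one_sub_id_le h)).2
    linarith
  · rcases lt_abs.1 h with h | h
    · have : Real.exp u ≤ Real.exp (u^2) := Real.exp_le_exp.2 (by nlinarith)
      linarith
    · have : Real.exp u ≤ 1 := Real.exp_le_one_iff.2 (by linarith)
      nlinarith

noncomputable def indS (S : Set ℝ) (x : ℝ) : ℝ := S.indicator (fun _ => (1:ℝ)) x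

lemma indS_meas {S : Set ℝ} (hS : MeasurableSet S) : Measurable (indS S) :=
  measurable_const.indicator hS

lemma indS_mem (S : Set ℝ) (x : ℝ) : indS S x = 0 ∨ indS S x = 1 := by
  by_cases h : x ∈ S <;> simp [indS, h]

lemma int_ind (ν : Measure ℝ) [IsProbabilityMeasure ν] {S : Set ℝ} (hS : MeasurableSet S) :
    ∫ x, indS S x ∂ν = ν.real S := by
  simp [indS, integral_indicator hS]

lemma ind_integrable (ν : Measure ℝ) [IsProbabilityMeasure ν] {S : Set ℝ}
    (hS : MeasurableSet S) : Integrable (indS S) ν :=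
  (integrable_const (1:ℝ)).indicator hS

lemma int_exp_ind (ν : Measure ℝ) [IsProbabilityMeasure ν] {S : Set ℝ} (hS : MeasurableSet S)
    (a : ℝ) : ∫ x, Real.exp (a * indS S x) ∂ν ≤ Real.exp (ν.real S * (Real.exp a - 1)) := by
  have h : ∀ x, Real.exp (a * indS S x) = 1 + (Real.exp a - 1) * indS S x := by
    intro x
    rcases indS_mem S x with h | h <;> simp [h]
  simp_rw [h]
  rw [integral_add (integrable_const _) ((ind_integrable ν hS).const_mul _), integral_const_mul,
    int_ind ν hS]
  have := Real.add_one_le_exp (ν.real S * (Real.exp a - 1))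
  simp
  linarith

section
variable {ι : Type*} [Fintype ι]

lemma mgf_bound (ν : Measure ℝ) [IsProbabilityMeasure ν] {S : Set ℝ}
    (hS : MeasurableSet S) (c : ι → ℝ) (hc : ∑ i, c i = 0) (hc1 : ∀ i, |c i| ≤ 1) (τ : ℝ) :
    ∫ z : ι → ℝ, Real.exp (∑ i, (τ * c i - τ^2) * indS S (z i))
      ∂(Measure.pi fun _ : ι => ν) ≤ 1 := by
  simp_rw [Real.exp_sum]
  rw [integral_fintype_prod_eq_prod (𝕜 := ℝ) (fun i x => Real.exp ((τ * c i - τ^2) * indS S x))]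
  calc _ ≤ ∏ i, Real.exp (ν.real S * (Real.exp (τ * c i - τ^2) - 1)) := by
        apply Finset.prod_le_prod
        · intro i _
          exact integral_nonneg fun x => (Real.exp_pos _).le
        · intro i _
          exact int_exp_ind ν hS _
    _ ≤ 1 := by
        rw [← Real.exp_sum, Real.exp_le_one_iff, ← Finset.mul_sum]
        apply mul_nonpos_of_nonneg_of_nonpos measureReal_nonneg
        have h1 : ∀ i, Real.exp (τ * c i - τ^2) - 1 ≤ τ * c i * Real.exp (-τ^2) := by
          intro i
          have h2 := exp_le_add_exp_sq (τ * c i)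
          have h3 : Real.exp ((τ * c i)^2) ≤ Real.exp (τ^2) := by
            apply Real.exp_le_exp.2
            have := (sq_le_one_iff_abs_le_one (c i)).2 (hc1 i)
            nlinarith [sq_nonneg τ]
          have h4 : Real.exp (τ^2) * Real.exp (-τ^2) = 1 := by
            rw [← Real.exp_add]; simp
          rw [sub_eq_add_neg (τ * c i), Real.exp_add]
          have h5 := Real.exp_pos (-τ^2)
          nlinarith
        calc _ ≤ ∑ i, τ * c i * Real.exp (-τ^2) := Finset.sum_le_sum fun i _ => h1 i
          _ = 0 := by rw [← Finset.sum_mul, ← Finset.mul_sum, hc]; simp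

lemma tail_k (ν : Measure ℝ) [IsProbabilityMeasure ν] {S : Set ℝ}
    (hS : MeasurableSet S) (c : ι → ℝ) (hc : ∑ i, c i = 0) (hc1 : ∀ i, |c i| ≤ 1)
    (l : ℝ) (hl : 0 ≤ l) (k : ℝ) (hk : 0 < k) :
    (Measure.pi fun _ : ι => ν).real {z | ∑ i, indS S (z i) = k ∧
      Real.sqrt (l * k) ≤ ∑ i, c i * indS S (z i)} ≤ Real.exp (-l/4) := by
  set x := Real.sqrt (l * k) with hx
  have hx2 : x^2 = l * k := Real.sq_sqrt (by positivity)
  set τ := x / (2 * k) with hτ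
  have hτ0 : 0 ≤ τ := by positivity
  set f : (ι → ℝ) → ℝ := fun z => Real.exp (∑ i, (τ * c i - τ^2) * indS S (z i)) with hf
  have hmeas : Measurable f := by
    apply Real.measurable_exp.comp
    apply Finset.measurable_sum
    intro i _
    exact ((indS_meas hS).comp (measurable_pi_apply i)).const_mul _
  have hint : Integrable f (Measure.pi fun _ : ι => ν) := by
    apply Integrable.of_bound hmeas.aestronglyMeasurable
      (Real.exp (∑ i, |τ * c i - τ^2|))
    refine Eventually.of_forall fun z => ?_
    rw [Real.norm_of_nonneg (Real.exp_pos _).le]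
    apply Real.exp_le_exp.2 (Finset.sum_le_sum fun i _ => ?_)
    rcases indS_mem S (z i) with h | h <;> simp [h, le_abs_self]
  have hM := mul_meas_ge_le_integral_of_nonneg (μ := Measure.pi fun _ : ι => ν) (f := f)
    (Eventually.of_forall fun z => (Real.exp_pos _).le) hint (Real.exp (l/4))
  have h1 := hM.trans (mgf_bound ν hS c hc hc1 τ)
  have hsub : {z : ι → ℝ | ∑ i, indS S (z i) = k ∧
      x ≤ ∑ i, c i * indS S (z i)} ⊆ {z | Real.exp (l/4) ≤ f z} := by
    rintro z ⟨h1, h2⟩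
    apply Real.exp_le_exp.2
    have : ∑ i, (τ * c i - τ^2) * indS S (z i) = τ * ∑ i, c i * indS S (z i) - τ^2 * k := by
      rw [← h1, Finset.mul_sum, Finset.mul_sum, ← Finset.sum_sub_distrib]
      exact Finset.sum_congr rfl fun i _ => by ring
    rw [this]
    have h3 := mul_le_mul_of_nonneg_left h2 hτ0
    have h4 : τ * x - τ^2 * k = l / 4 := by
      rw [hτ]; field_simp; rw [hx2]; ring
    linarith
  have h2 := measureReal_mono (μ := Measure.pi fun _ : ι => ν) hsub (measure_ne_top _ _)
  refine h2.trans ?_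
  have h4 : Real.exp (-l/4) * Real.exp (l/4) = 1 := by
    rw [← Real.exp_add]; simp; ring
  have h5 := Real.exp_pos (-l/4)
  rw [measureReal_def]
  rw [measureReal_def] at h1
  nlinarith

lemma sum_ind_nat (S : Set ℝ) (z : ι → ℝ) :
    ∃ k ∈ Finset.range (Fintype.card ι + 1), ∑ i, indS S (z i) = (k : ℝ) := by
  classical
  refine ⟨(Finset.univ.filter fun i => z i ∈ S).card, ?_, ?_⟩
  · rw [Finset.mem_range, Nat.lt_succ_iff]; exact Finset.card_le_univ _
  · simp [indS, Set.indicator_apply]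

/-- bad event -/
def bad (l : ℝ) (c : ι → ℝ) (S : Set ℝ) : Set (ι → ℝ) :=
  {z | 0 < ∑ i, indS S (z i) ∧ 0 ≤ ∑ i, c i * indS S (z i) ∧
    l * ∑ i, indS S (z i) ≤ (∑ i, c i * indS S (z i))^2}

lemma tail_all (ν : Measure ℝ) [IsProbabilityMeasure ν] {S : Set ℝ}
    (hS : MeasurableSet S) (c : ι → ℝ) (hc : ∑ i, c i = 0) (hc1 : ∀ i, |c i| ≤ 1)
    (l : ℝ) (hl : 0 ≤ l) :
    (Measure.pi fun _ : ι => ν).real (bad l c S) ≤ Fintype.card ι * Real.exp (-l/4) := by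
  have hsub : bad l c S ⊆ ⋃ k ∈ Finset.range (Fintype.card ι),
      {z : ι → ℝ | ∑ i, indS S (z i) = ((k + 1 : ℕ) : ℝ) ∧
      Real.sqrt (l * ((k + 1 : ℕ) : ℝ)) ≤ ∑ i, c i * indS S (z i)} := by
    rintro z ⟨h1, h2, h3⟩
    obtain ⟨k, hk, hk2⟩ := sum_ind_nat S z
    rw [Finset.mem_range] at hk
    have hk0 : 0 < k := by
      rw [hk2] at h1; exact_mod_cast h1
    simp only [mem_iUnion]
    refine ⟨k - 1, Finset.mem_range.2 (by omega), ?_⟩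
    rw [mem_ofPred_eq, Nat.sub_add_cancel hk0, ← hk2]
    exact ⟨rfl, Real.sqrt_le_iff.2 ⟨h2, h3⟩⟩
  refine (measureReal_mono hsub (measure_ne_top _ _)).trans ?_
  refine (measureReal_biUnion_finset_le _ _).trans ?_
  calc _ ≤ ∑ k ∈ Finset.range (Fintype.card ι), Real.exp (-l/4) :=
        Finset.sum_le_sum fun k _ => tail_k ν hS c hc hc1 l hl _ (by positivity)
    _ = _ := by simp

lemma coll_pair (ν : Measure ℝ) [IsProbabilityMeasure ν] {S : Set ℝ}
    (hS : MeasurableSet S) {i j : ι} (hij : i ≠ j) :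
    (Measure.pi fun _ : ι => ν).real {z | z i ∈ S ∧ z j ∈ S} = ν.real S ^ 2 := by
  classical
  have h := (iIndepFun_pi (μ := fun _ : ι => ν) (X := fun _ x => x) (fun _ => aemeasurable_id)).indepFun hij
  have h2 := h.measure_inter_preimage_eq_mul S S hS hS
  have e (i : ι) : (Measure.pi fun _ : ι => ν) ((fun z => z i) ⁻¹' S) = ν S :=
    (measurePreserving_eval (fun _ : ι => ν) i).measure_preimage hS.nullMeasurableSet
  rw [e, e] at h2
  have : {z : ι → ℝ | z i ∈ S ∧ z j ∈ S} = (fun z => z i) ⁻¹' S ∩ (fun z => z j) ⁻¹' S := rfl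
  rw [measureReal_def, this, h2]
  simp [measureReal_def, sq]
end

lemma exists_U (P : Measure ℝ) [IsProbabilityMeasure P]
    (F : ℝ → ℝ) (hF : ∀ t, F t = (P (Set.Iic t)).toReal) (hFcont : Continuous F) (M : ℕ)
    (hM : 0 < M) : ∃ U : ℕ → Set ℝ, U 0 = ∅ ∧ U M = univ ∧ ∀ j ≤ M, MeasurableSet (U j) ∧
      IsLowerSet (U j) ∧ P.real (U j) = (j : ℝ) / M := by
  have hM' : (0:ℝ) < M := by exact_mod_cast hM
  have hcdf : F = cdf P := by
    ext t; rw [hF, cdf_eq_real, measureReal_def]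
  have h0 : Tendsto F atBot (𝓝 0) := hcdf ▸ tendsto_cdf_atBot P
  have h1 : Tendsto F atTop (𝓝 1) := hcdf ▸ tendsto_cdf_atTop P
  have key : ∀ j : ℕ, ∃ g, (0 < j → j < M → F g = (j:ℝ) / M) := by
    intro j
    by_cases hj : 0 < j ∧ j < M
    · have hj1 : (0:ℝ) < j := by exact_mod_cast hj.1
      have hj2 : (j:ℝ) < M := by exact_mod_cast hj.2
      obtain ⟨g, hg⟩ := mem_range_of_exists_le_of_exists_ge (c := (j:ℝ)/M) hFcont
        (h0.eventually_le_const (by positivity)).exists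
        (h1.eventually_const_le ((div_lt_one hM').2 hj2)).exists
      exact ⟨g, fun _ _ => hg⟩
    · exact ⟨0, fun a b => absurd ⟨a, b⟩ hj⟩
  choose g hg using key
  refine ⟨fun j => if j = 0 then ∅ else if j < M then Iic (g j) else univ, by simp,
    by simp [hM.ne'], ?_⟩
  intro j hj
  by_cases hj0 : j = 0
  · subst hj0
    simp [isLowerSet_empty]
  by_cases hjM : j < M
  · simp only [hj0, hjM, if_true, if_false]
    refine ⟨measurableSet_Iic, isLowerSet_Iic _, ?_⟩
    rw [measureReal_def, ← hF, hg j (by omega) hjM]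
  · have : j = M := by omega
    subst this
    simp [hj0, isLowerSet_univ]

section
variable {ι : Type*} [Fintype ι]

def collE (ι : Type*) (U : ℕ → Set ℝ) (M : ℕ) : Set (ι → ℝ) :=
  {z | ∃ j < M, ∃ i i', i ≠ i' ∧ z i ∈ U (j+1) \ U j ∧ z i' ∈ U (j+1) \ U j}

lemma coll_bound (P : Measure ℝ) [IsProbabilityMeasure P] (U : ℕ → Set ℝ) (M : ℕ) (hM : 0 < M)
    (hU : ∀ j ≤ M, MeasurableSet (U j) ∧ IsLowerSet (U j) ∧ P.real (U j) = (j : ℝ) / M) :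
    (Measure.pi fun _ : ι => P).real (collE ι U M) ≤ (Fintype.card ι : ℝ)^2 / M := by
  classical
  have hM' : (0:ℝ) < M := by exact_mod_cast hM
  have hC : ∀ j < M, P.real (U (j+1) \ U j) = 1 / M := by
    intro j hj
    obtain ⟨a1, a2, a3⟩ := hU j hj.le
    obtain ⟨b1, b2, b3⟩ := hU (j+1) hj
    have hs : U j ⊆ U (j+1) := by
      rcases a2.total b2 with h | h
      · exact h
      · have := measureReal_mono (μ := P) h
        rw [a3, b3] at this
        rw [div_le_div_iff_of_pos_right hM'] at this
        push_cast at this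
        linarith
    rw [measureReal_sdiff hs a1, a3, b3]
    push_cast
    field_simp
    ring
  have hsub : collE ι U M ⊆ ⋃ q ∈ (Finset.range M) ×ˢ (Finset.univ : Finset ι).offDiag,
      {z : ι → ℝ | z q.2.1 ∈ U (q.1+1) \ U q.1 ∧ z q.2.2 ∈ U (q.1+1) \ U q.1} := by
    rintro z ⟨j, hj, i, i', hne, h1, h2⟩
    simp only [mem_iUnion]
    exact ⟨(j, i, i'), by simp [hj, hne], h1, h2⟩
  refine (measureReal_mono hsub (measure_ne_top _ _)).trans ?_
  refine (measureReal_biUnion_finset_le _ _).trans ?_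
  calc _ ≤ ∑ q ∈ (Finset.range M) ×ˢ (Finset.univ : Finset ι).offDiag, (1 / (M:ℝ))^2 := by
        refine Finset.sum_le_sum fun q hq => ?_
        simp only [Finset.mem_product, Finset.mem_range, Finset.mem_offDiag] at hq
        rw [coll_pair P ((hU _ hq.1).1.diff (hU _ hq.1.le).1) hq.2.2.2, hC _ hq.1]
    _ ≤ _ := by
        rw [Finset.sum_const, Finset.card_product, Finset.offDiag_card, Finset.card_range,
          nsmul_eq_mul, Finset.card_univ]
        have : ((M * (Fintype.card ι * Fintype.card ι - Fintype.card ι) : ℕ) : ℝ)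
          ≤ M * (Fintype.card ι : ℝ)^2 := by
          rw [sq]
          exact_mod_cast Nat.mul_le_mul_left _ (Nat.sub_le _ _)
        calc _ ≤ M * (Fintype.card ι : ℝ)^2 * (1 / (M:ℝ))^2 := by gcongr
          _ = _ := by field_simp

lemma sandwich {U : ℕ → Set ℝ} {M : ℕ} (h0 : U 0 = ∅) (h1 : U M = univ)
    (hU : ∀ j ≤ M, IsLowerSet (U j)) {z : ι → ℝ} (hz : z ∉ collE ι U M) (t : ℝ) :
    ∃ j ≤ M, ∀ i, z i ≤ t ↔ z i ∈ U j := by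
  classical
  set j := Nat.findGreatest (fun j => U j ⊆ Iic t) M with hj
  have hjM : j ≤ M := Nat.findGreatest_le _
  have hjU : U j ⊆ Iic t :=
    Nat.findGreatest_spec (P := fun j => U j ⊆ Iic t) (Nat.zero_le M) (by simp [h0])
  rcases eq_or_lt_of_le hjM with hE | hlt
  · refine ⟨M, le_rfl, fun i => ?_⟩
    rw [hE, h1] at hjU
    simp only [h1, mem_univ, iff_true]
    exact hjU (mem_univ (z i))
  · have hn : ¬ U (j+1) ⊆ Iic t :=
      Nat.findGreatest_is_greatest (P := fun j => U j ⊆ Iic t) (Nat.lt_succ_self _) hlt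
    have hs : Iic t ⊆ U (j+1) := ((isLowerSet_Iic t).total (hU (j+1) hlt)).resolve_right hn
    by_cases hex : ∃ i, z i ∈ U (j+1) \ U j ∧ z i ≤ t
    · obtain ⟨i0, hi0, hi0t⟩ := hex
      refine ⟨j+1, hlt, fun i => ⟨fun h => hs h, fun h => ?_⟩⟩
      by_cases hi : z i ∈ U j
      · exact hjU hi
      · by_cases he : i = i0
        · rwa [he]
        · exact absurd ⟨j, hlt, i, i0, he, ⟨h, hi⟩, hi0⟩ hz
    · refine ⟨j, hjM, fun i => ⟨fun h => ?_, fun h => hjU h⟩⟩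
      by_contra hc
      exact hex ⟨i, ⟨hs h, hc⟩, h⟩

end

lemma indS_compl (S : Set ℝ) (x : ℝ) : indS Sᶜ x = 1 - indS S x := by
  by_cases h : x ∈ S <;> simp [indS, h]

lemma empCDF_eq {k : ℕ} (x : Fin k → ℝ) (t : ℝ) :
    empCDF x t = (∑ i, indS (Iic t) (x i)) / k := by
  simp [empCDF, indS, Set.indicator_apply]

noncomputable def cw (m n : ℕ) : Fin m ⊕ Fin n → ℝ := Sum.elim (fun _ => (n:ℝ)/m) (fun _ => -1)

lemma real_core (m n A B L : ℝ) (hm : 0 < m) (hn : 0 < n) (hL : 0 < L)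
    (hA : 0 ≤ A) (hB : 0 ≤ B) (hA' : A ≤ m) (hB' : B ≤ n)
    (h : L ≤ Real.sqrt (m * n / (m + n)) * (A / m - B / n) /
      Real.sqrt ((m * (A / m) + n * (B / n)) / (m + n) *
        (1 - (m * (A / m) + n * (B / n)) / (m + n)))) :
    0 ≤ n / m * A - B ∧ ((0 < A + B ∧ L^2 * (n/m) / 2 * (A + B) ≤ (n / m * A - B)^2) ∨
      (0 < m + n - (A + B) ∧ L^2 * (n/m) / 2 * (m + n - (A + B)) ≤ (n / m * A - B)^2)) := by
  have e1 : m * (A / m) + n * (B / n) = A + B := by field_simp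
  have e2 : A / m - B / n = (n / m * A - B) / n := by field_simp
  rw [e1, e2] at h
  set K := A + B with hK
  set D := n / m * A - B with hD
  have hN : 0 < m + n := by positivity
  set q := K / (m+n) * (1 - K / (m+n)) with hq
  have hq' : q = K * (m + n - K) / (m+n)^2 := by rw [hq]; field_simp
  have hqpos : 0 < q := by
    by_contra hc
    rw [Real.sqrt_eq_zero_of_nonpos (not_lt.1 hc)] at h
    simp at h; linarith
  have hs : 0 < Real.sqrt q := Real.sqrt_pos.2 hqpos
  rw [le_div_iff₀ hs] at h
  have hpos : 0 < Real.sqrt (m * n / (m + n)) * (D / n) := lt_of_lt_of_le (by positivity) h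
  have hs2 : 0 < Real.sqrt (m * n / (m + n)) := by positivity
  have hDn : 0 < D / n := (pos_iff_pos_of_mul_pos hpos).1 hs2
  have hD0 : 0 < D := by
    have := mul_pos hDn hn
    rwa [div_mul_cancel₀ _ hn.ne'] at this
  have hsq := pow_le_pow_left₀ (by positivity) h 2
  rw [mul_pow, mul_pow, Real.sq_sqrt hqpos.le, Real.sq_sqrt (by positivity), hq'] at hsq
  have hKK : 0 < K * (m + n - K) := by
    rw [hq'] at hqpos
    have := mul_pos hqpos (by positivity : 0 < (m+n)^2)
    rwa [div_mul_cancel₀ _ (by positivity)] at this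
  have hK0 : 0 ≤ K := by positivity
  have hKp : 0 < K := lt_of_le_of_ne hK0 (by rintro h; rw [← h] at hKK; simp at hKK)
  have hK'p : 0 < m + n - K := (pos_iff_pos_of_mul_pos hKK).1 hKp
  have hmain : L^2 * (n/m) * (K * (m + n - K) / (m+n)) ≤ D^2 := by
    have e3 : L^2 * (n/m) * (K * (m + n - K) / (m+n)) =
      (L^2 * (K * (m + n - K) / (m+n)^2)) * (n * (m+n) / m) := by field_simp
    have e4 : D^2 = (m * n / (m+n) * (D/n)^2) * (n * (m+n) / m) := by field_simp
    rw [e3, e4]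
    gcongr
  refine ⟨hD0.le, ?_⟩
  have hc : 0 ≤ L^2 * (n/m) := by positivity
  rcases le_total K ((m+n)/2) with hh | hh
  · left
    refine ⟨hKp, le_trans ?_ hmain⟩
    have : K / 2 ≤ K * (m + n - K) / (m+n) := by
      rw [div_le_div_iff₀ (by norm_num) hN]; nlinarith
    nlinarith [mul_le_mul_of_nonneg_left this hc]
  · right
    refine ⟨hK'p, le_trans ?_ hmain⟩
    have : (m + n - K) / 2 ≤ K * (m + n - K) / (m+n) := by
      rw [div_le_div_iff₀ (by norm_num) hN]; nlinarith
    nlinarith [mul_le_mul_of_nonneg_left this hc]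

lemma indS_sum_bd {k : ℕ} (S : Set ℝ) (x : Fin k → ℝ) :
    0 ≤ ∑ i, indS S (x i) ∧ ∑ i, indS S (x i) ≤ k := by
  constructor
  · exact Finset.sum_nonneg fun i _ => by rcases indS_mem S (x i) with h | h <;> simp [h]
  · calc _ ≤ ∑ i : Fin k, (1:ℝ) :=
        Finset.sum_le_sum fun i _ => by rcases indS_mem S (x i) with h | h <;> simp [h]
      _ = k := by simp

lemma cw_sum {m n : ℕ} (hm : 0 < m) : ∑ i, cw m n i = 0 := by
  have : (m:ℝ) ≠ 0 := by positivity
  simp [cw]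
  field_simp
  ring

lemma cw_abs {m n : ℕ} (hmn : n ≤ m) (i) : |cw m n i| ≤ 1 := by
  rcases i with i | i
  · simp only [cw, Sum.elim_inl]
    rw [abs_of_nonneg (by positivity)]
    exact div_le_one_of_le₀ (by exact_mod_cast hmn) (by positivity)
  · simp [cw]

lemma Z_bad {m n : ℕ} (hm : 0 < m) (hn : 0 < n) (L : ℝ) (hL : 0 < L) (t : ℝ)
    (z : Fin m ⊕ Fin n → ℝ) (S : Set ℝ) (hS : ∀ i, z i ≤ t ↔ z i ∈ S)
    (h : L ≤ Real.sqrt (((m : ℝ) * n) / ((m : ℝ) + n)) *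
      (empCDF (fun i => z (.inl i)) t - empCDF (fun i => z (.inr i)) t) /
    Real.sqrt (pooledCDF (fun i => z (.inl i)) (fun i => z (.inr i)) t *
      (1 - pooledCDF (fun i => z (.inl i)) (fun i => z (.inr i)) t))) :
    z ∈ bad (L^2 * ((n:ℝ)/m) / 2) (cw m n) S ∨
    z ∈ bad (L^2 * ((n:ℝ)/m) / 2) (fun i => - cw m n i) Sᶜ := by
  have hI : ∀ i, indS (Iic t) (z i) = indS S (z i) := by
    intro i
    by_cases h : z i ∈ S
    · have := (hS i).2 h
      simp [indS, h, this]
    · have := (hS i).not.2 h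
      simp [indS, h, this]
  rw [pooledCDF, empCDF_eq, empCDF_eq] at h
  simp only [hI] at h
  have hm' : (0:ℝ) < m := by exact_mod_cast hm
  have hn' : (0:ℝ) < n := by exact_mod_cast hn
  obtain ⟨hD, hK⟩ := real_core m n _ _ L hm' hn' hL (indS_sum_bd S _).1 (indS_sum_bd S _).1
    (indS_sum_bd S _).2 (indS_sum_bd S _).2 h
  have eK : ∑ i, indS S (z i) = ∑ i, indS S (z (.inl i)) + ∑ i, indS S (z (.inr i)) :=
    Fintype.sum_sum_type _
  have eD : ∑ i, cw m n i * indS S (z i) =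
      n / m * ∑ i, indS S (z (.inl i)) - ∑ i, indS S (z (.inr i)) := by
    rw [Fintype.sum_sum_type, Finset.mul_sum]
    simp [cw, sub_eq_add_neg]
  have eK' : ∑ i, indS Sᶜ (z i) =
      m + n - (∑ i, indS S (z (.inl i)) + ∑ i, indS S (z (.inr i))) := by
    simp only [indS_compl]
    rw [Finset.sum_sub_distrib, eK]
    simp
  have eD' : ∑ i, (-cw m n i) * indS Sᶜ (z i) =
      n / m * ∑ i, indS S (z (.inl i)) - ∑ i, indS S (z (.inr i)) := by
    have : ∀ i, (-cw m n i) * indS Sᶜ (z i) = cw m n i * indS S (z i) - cw m n i := by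
      intro i; rw [indS_compl]; ring
    simp only [this]
    rw [Finset.sum_sub_distrib, cw_sum hm, eD, sub_zero]
  rcases hK with hK | hK
  · left
    rw [bad, mem_ofPred_eq, eD, eK]
    exact ⟨hK.1, hD, hK.2⟩
  · right
    rw [bad, mem_ofPred_eq, eD', eK']
    exact ⟨hK.1, hD, hK.2⟩

lemma Z_range_finite {m n : ℕ} (x : Fin m → ℝ) (y : Fin n → ℝ) :
    (range fun t : ℝ => Real.sqrt (((m : ℝ) * n) / ((m : ℝ) + n)) * (empCDF x t - empCDF y t) /
    Real.sqrt (pooledCDF x y t * (1 - pooledCDF x y t))).Finite := by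
  classical
  let f : Finset (Fin m) × Finset (Fin n) → ℝ := fun p =>
    Real.sqrt (((m : ℝ) * n) / ((m : ℝ) + n)) * ((p.1.card : ℝ)/m - (p.2.card : ℝ)/n) /
    Real.sqrt ((((m : ℝ) * ((p.1.card : ℝ)/m) + (n : ℝ) * ((p.2.card : ℝ)/n)) / ((m : ℝ) + n)) *
      (1 - (((m : ℝ) * ((p.1.card : ℝ)/m) + (n : ℝ) * ((p.2.card : ℝ)/n)) / ((m : ℝ) + n))))
  refine (Set.finite_range f).subset ?_
  rintro _ ⟨t, rfl⟩
  exact ⟨(Finset.univ.filter fun i => x i ≤ t, Finset.univ.filter fun i => y i ≤ t), rfl⟩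

lemma typeI_bound (P : Measure ℝ) [IsProbabilityMeasure P]
    (F : ℝ → ℝ) (hF : ∀ t, F t = (P (Set.Iic t)).toReal) (hFcont : Continuous F)
    {m n : ℕ} (hn : 0 < n) (hmn : n ≤ m) (L : ℝ) (hL : 0 < L) (M : ℕ) (hM : 0 < M) :
    (((Measure.pi fun _ : Fin m => P).prod (Measure.pi fun _ : Fin n => P))
        {ω | L ≤ HCstat ω.1 ω.2}).toReal ≤
    ((m:ℝ) + n)^2 / M + (M + 1) * (2 * (((m:ℝ) + n) * Real.exp (-(L^2 * ((n:ℝ)/m) / 2)/4))) := by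
  have hm : 0 < m := by omega
  obtain ⟨U, hU0, hUM, hU⟩ := exists_U P F hF hFcont M hM
  rw [← (measurePreserving_sumPiEquivProdPi
    (fun _ : Fin m ⊕ Fin n => P)).measure_preimage_equiv, ← measureReal_def]
  set l := L^2 * ((n:ℝ)/m) / 2 with hl
  have hl0 : 0 ≤ l := by positivity
  have hsub : (MeasurableEquiv.sumPiEquivProdPi fun _ : Fin m ⊕ Fin n => ℝ) ⁻¹'
      {ω | L ≤ HCstat ω.1 ω.2} ⊆ collE (Fin m ⊕ Fin n) U M ∪
      ⋃ j ∈ Finset.range (M+1), (bad l (cw m n) (U j) ∪ bad l (fun i => - cw m n i) (U j)ᶜ) := by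
    intro z hz
    by_cases hc : z ∈ collE (Fin m ⊕ Fin n) U M
    · exact Or.inl hc
    right
    have hz' : L ≤ HCstat (fun i => z (.inl i)) (fun i => z (.inr i)) := hz
    obtain ⟨t, ht⟩ := (range_nonempty _).csSup_mem
      (Z_range_finite (fun i => z (.inl i)) (fun i => z (.inr i)))
    rw [HCstat, iSup, ← ht] at hz'
    obtain ⟨j, hj, hjS⟩ := sandwich hU0 hUM (fun j hj => (hU j hj).2.1) hc t
    simp only [mem_iUnion]
    exact ⟨j, Finset.mem_range.2 (by omega), Z_bad hm hn L hL t z (U j) hjS hz'⟩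
  refine (measureReal_mono hsub (measure_ne_top _ _)).trans ?_
  refine (measureReal_union_le _ _).trans ?_
  have hcard : (Fintype.card (Fin m ⊕ Fin n) : ℝ) = m + n := by simp
  refine add_le_add ?_ ?_
  · have := coll_bound (ι := Fin m ⊕ Fin n) P U M hM hU
    rwa [hcard] at this
  · refine (measureReal_biUnion_finset_le _ _).trans ?_
    have hb : ∀ j ∈ Finset.range (M+1), (Measure.pi fun _ : Fin m ⊕ Fin n => P).real
        (bad l (cw m n) (U j) ∪ bad l (fun i => - cw m n i) (U j)ᶜ) ≤
        2 * (((m:ℝ) + n) * Real.exp (-l/4)) := by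
      intro j hj
      have hj' : j ≤ M := by rw [Finset.mem_range] at hj; omega
      refine (measureReal_union_le _ _).trans ?_
      have h1 := tail_all P (hU j hj').1 (cw m n) (cw_sum hm) (cw_abs hmn) l hl0
      have h2 := tail_all P (hU j hj').1.compl (fun i => - cw m n i)
        (by rw [Finset.sum_neg_distrib, cw_sum hm, neg_zero])
        (fun i => by rw [abs_neg]; exact cw_abs hmn i) l hl0
      rw [hcard] at h1 h2
      linarith
    calc _ ≤ ∑ j ∈ Finset.range (M+1), 2 * (((m:ℝ) + n) * Real.exp (-l/4)) :=
          Finset.sum_le_sum hb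
      _ = _ := by rw [Finset.sum_const, Finset.card_range, nsmul_eq_mul]; push_cast; ring

lemma real_core2 (m n A B d : ℝ) (hn : 0 < n) (hmn : n ≤ m)
    (hA : 0 ≤ A) (hB : 0 ≤ B) (hA' : A ≤ m) (hB' : B ≤ n) (hd : d = A / m - B / n) (hd0 : 0 < d) :
    Real.sqrt n * d ≤ Real.sqrt (m * n / (m + n)) * (A / m - B / n) /
      Real.sqrt ((m * (A / m) + n * (B / n)) / (m + n) *
        (1 - (m * (A / m) + n * (B / n)) / (m + n))) := by
  have hm : 0 < m := by linarith
  have hN : 0 < m + n := by linarith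
  have e1 : m * (A / m) + n * (B / n) = A + B := by field_simp
  rw [e1, ← hd]
  set H := (A + B) / (m+n) with hH
  have hq4 : H * (1 - H) ≤ (1/2)^2 := by nlinarith [sq_nonneg (H - 1/2)]
  have hH0 : 0 < H := by
    apply div_pos _ hN
    rcases hA.lt_or_eq with h | h
    · linarith
    · rw [← h] at hd
      have : 0 ≤ B / n := by positivity
      simp at hd; linarith
  have hH1 : H < 1 := by
    rw [hH, div_lt_one hN]
    rcases hB'.lt_or_eq with h | h
    · linarith
    · rw [h, div_self hn.ne'] at hd
      have : A / m ≤ 1 := (div_le_one hm).2 hA'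
      linarith
  have hq : 0 < H * (1 - H) := mul_pos hH0 (by linarith)
  have hs : Real.sqrt (H * (1 - H)) ≤ 1/2 := Real.sqrt_le_iff.2 ⟨by norm_num, hq4⟩
  have hs0 : 0 < Real.sqrt (H * (1 - H)) := Real.sqrt_pos.2 hq
  have h1 : Real.sqrt n * (1/2) ≤ Real.sqrt (m * n / (m + n)) := by
    apply Real.le_sqrt_of_sq_le
    rw [mul_pow, Real.sq_sqrt hn.le, le_div_iff₀ hN]
    nlinarith
  rw [le_div_iff₀ hs0]
  calc Real.sqrt n * d * Real.sqrt (H * (1 - H)) ≤ Real.sqrt n * d * (1/2) := by gcongr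
    _ = Real.sqrt n * (1/2) * d := by ring
    _ ≤ _ := by gcongr

lemma var_ind (ν : Measure ℝ) [IsProbabilityMeasure ν] {S : Set ℝ} (hS : MeasurableSet S)
    (a : ℝ) : MemLp (fun x => a * indS S x) 2 ν ∧
      Var[fun x => a * indS S x; ν] ≤ a^2 := by
  have hb : ∀ x, |indS S x| ≤ 1 := fun x => by rcases indS_mem S x with h | h <;> simp [h]
  have hM : MemLp (indS S) 2 ν :=
    MemLp.of_bound (indS_meas hS).aestronglyMeasurable 1 (Eventually.of_forall hb)
  refine ⟨hM.const_mul a, ?_⟩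
  rw [variance_const_mul]
  have h1 : Var[indS S; ν] ≤ 1 := by
    refine (variance_le_expectation_sq (indS_meas hS).aestronglyMeasurable).trans ?_
    have : (indS S ^ 2) = indS S := by
      ext x; rcases indS_mem S x with h | h <;> simp [h]
    rw [this, int_ind ν hS]
    exact measureReal_le_one
  nlinarith [sq_nonneg a]

lemma power_bound (P Q : Measure ℝ) [IsProbabilityMeasure P] [IsProbabilityMeasure Q]
    {m n : ℕ} (hn : 0 < n) (hmn : n ≤ m) (L t δ : ℝ)
    (hδ : δ = P.real (Iic t) - Q.real (Iic t)) (hδ0 : 0 < δ) (hL : 2 * L ≤ Real.sqrt n * δ) :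
    1 - 8 / (n * δ^2) ≤ (((Measure.pi fun _ : Fin m => P).prod (Measure.pi fun _ : Fin n => Q))
        {ω | L ≤ HCstat ω.1 ω.2}).toReal := by
  have hm : 0 < m := by omega
  have hm' : (0:ℝ) < m := by exact_mod_cast hm
  have hn' : (0:ℝ) < n := by exact_mod_cast hn
  have hmn' : (n:ℝ) ≤ m := by exact_mod_cast hmn
  set ν : Fin m ⊕ Fin n → Measure ℝ := Sum.elim (fun _ => P) (fun _ => Q) with hν
  haveI : ∀ i, IsProbabilityMeasure (ν i) := by
    rintro (i | i) <;> simp only [hν, Sum.elim_inl, Sum.elim_inr] <;> infer_instance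
  have hpre := (measurePreserving_sumPiEquivProdPi ν).measure_preimage_equiv
    {ω | L ≤ HCstat ω.1 ω.2}
  simp only [hν, Sum.elim_inl, Sum.elim_inr] at hpre
  rw [← hpre, ← hν, ← measureReal_def]
  set a : Fin m ⊕ Fin n → ℝ := Sum.elim (fun _ => 1/(m:ℝ)) (fun _ => -1/(n:ℝ)) with ha
  have hS : MeasurableSet (Iic t) := measurableSet_Iic
  set X : (Fin m ⊕ Fin n → ℝ) → ℝ := ∑ i, fun z => a i * indS (Iic t) (z i) with hX
  have hXz : ∀ z, X z = (∑ i, indS (Iic t) (z (.inl i))) / m -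
      (∑ i, indS (Iic t) (z (.inr i))) / n := by
    intro z
    rw [hX, Finset.sum_apply, Fintype.sum_sum_type, Finset.sum_div, Finset.sum_div,
      sub_eq_add_neg, ← Finset.sum_neg_distrib]
    simp only [ha, Sum.elim_inl, Sum.elim_inr]
    congr 1 <;> exact Finset.sum_congr rfl fun i _ => by ring
  have hmem : ∀ i, MemLp (fun z : Fin m ⊕ Fin n → ℝ => a i * indS (Iic t) (z i)) 2
      (Measure.pi ν) := fun i =>
    (var_ind (ν i) hS (a i)).1.comp_measurePreserving (measurePreserving_eval ν i)
  have hXmem : MemLp X 2 (Measure.pi ν) := by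
    rw [hX]; exact memLp_finsetSum' _ fun i _ => hmem i
  have hvar : Var[X; Measure.pi ν] ≤ 2 / n := by
    rw [hX, variance_sum_pi (μ := ν) (X := fun i x => a i * indS (Iic t) x)
      fun i => (var_ind (ν i) hS (a i)).1]
    calc _ ≤ ∑ i, (a i)^2 := Finset.sum_le_sum fun i _ => (var_ind (ν i) hS (a i)).2
      _ = 1 / m + 1 / n := by
        rw [Fintype.sum_sum_type]
        simp only [ha, Sum.elim_inl, Sum.elim_inr, Finset.sum_const, Finset.card_univ,
          Fintype.card_fin, nsmul_eq_mul]
        field_simp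
      _ ≤ 1 / n + 1 / n := by gcongr
      _ = 2 / n := by ring
  have hmean : ∫ z, X z ∂(Measure.pi ν) = δ := by
    have : ∀ z, X z = ∑ i, a i * indS (Iic t) (z i) := fun z => by rw [hX, Finset.sum_apply]
    simp_rw [this]
    rw [integral_finsetSum _ fun i _ => (hmem i).integrable (by norm_num)]
    have hI : ∀ i, ∫ z, a i * indS (Iic t) (z i) ∂(Measure.pi ν) = a i * (ν i).real (Iic t) := by
      intro i
      rw [integral_comp_eval (μ := ν) (i := i) (f := fun x => a i * indS (Iic t) x)
        (var_ind (ν i) hS (a i)).1.aestronglyMeasurable, integral_const_mul, int_ind (ν i) hS]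
    simp_rw [hI]
    rw [Fintype.sum_sum_type]
    simp only [ha, hν, Sum.elim_inl, Sum.elim_inr, Finset.sum_const, Finset.card_univ,
          Fintype.card_fin, nsmul_eq_mul]
    rw [hδ]
    field_simp
    ring
  have hcheb := meas_ge_le_variance_div_sq hXmem (half_pos hδ0)
  rw [hmean] at hcheb
  have hcheb2 : (Measure.pi ν).real {ω | δ / 2 ≤ |X ω - δ|} ≤ 8 / (n * δ^2) := by
    rw [measureReal_def]
    refine (ENNReal.toReal_mono ENNReal.ofReal_ne_top hcheb).trans ?_
    rw [ENNReal.toReal_ofReal (div_nonneg (variance_nonneg _ _) (by positivity))]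
    calc _ ≤ (2 / n) / (δ/2)^2 := by gcongr
      _ = _ := by field_simp; norm_num
  set E := (MeasurableEquiv.sumPiEquivProdPi fun _ : Fin m ⊕ Fin n => ℝ) ⁻¹'
      {ω | L ≤ HCstat ω.1 ω.2} with hE
  have hun : (univ : Set (Fin m ⊕ Fin n → ℝ)) ⊆ E ∪ {ω | δ / 2 ≤ |X ω - δ|} := by
    intro z _
    by_cases hz : δ / 2 ≤ |X z - δ|
    · exact Or.inr hz
    left
    change L ≤ HCstat (fun i => z (.inl i)) (fun i => z (.inr i))
    have hz2 := (abs_lt.1 (not_le.1 hz)).1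
    have hXd : δ / 2 < X z := by linarith
    have h1 := real_core2 m n _ _ (X z) hn' hmn' (indS_sum_bd (Iic t) _).1
      (indS_sum_bd (Iic t) _).1 (indS_sum_bd (Iic t) _).2 (indS_sum_bd (Iic t) _).2 (hXz z)
      (by linarith)
    rw [← empCDF_eq, ← empCDF_eq] at h1
    have h2 := le_ciSup (Z_range_finite (fun i => z (.inl i)) (fun i => z (.inr i))).bddAbove t
    have h3 : Real.sqrt n * (δ/2) ≤ Real.sqrt n * X z := by gcongr
    have h4 : L ≤ Real.sqrt n * X z := by linarith
    exact h4.trans (h1.trans h2)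
  have h1 := measureReal_mono (μ := Measure.pi ν) hun (measure_ne_top _ _)
  have h2 := measureReal_union_le (μ := Measure.pi ν) E {ω | δ / 2 ≤ |X ω - δ|}
  rw [probReal_univ] at h1
  linarith

lemma typeI_simple {m n η : ℝ} (hn : 1 ≤ n) (hmn : n ≤ m) (hη : 0 < η)
    (hr : η / 2 ≤ n / (m + n)) (hl : 80 / η ≤ Real.log n) :
    (m + n)^2 / (m+n)^3 + ((m+n)^3 + 1) * (2 * ((m + n) *
      Real.exp (-((Real.log n)^2 * (n/m) / 2)/4))) ≤ (1 + 4 * (2/η)^4) / n := by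
  have hm : 0 < m := by linarith
  have hN : 0 < m + n := by linarith
  have hn0 : 0 < n := by linarith
  have hN2 : m + n ≤ 2 / η * n := by
    rw [div_le_div_iff₀ (by norm_num) hN] at hr
    rw [div_mul_eq_mul_div, le_div_iff₀ hη]; linarith
  have hr2 : η / 2 ≤ n / m := hr.trans (by gcongr; linarith)
  have hlog : 0 ≤ Real.log n := Real.log_nonneg hn
  have h5 : 80 ≤ Real.log n * η := by rwa [div_le_iff₀ hη] at hl
  have hexp : Real.exp (-((Real.log n)^2 * (n/m) / 2)/4) ≤ 1 / n^5 := by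
    have : (1 / n^5 : ℝ) = Real.exp (-(5 * Real.log n)) := by
      rw [Real.exp_neg, mul_comm, Real.exp_mul, Real.exp_log hn0, one_div]
      norm_cast
    rw [this]
    apply Real.exp_le_exp.2
    have h6 : (Real.log n)^2 * (η/2) ≤ (Real.log n)^2 * (n/m) := by gcongr
    nlinarith
  have hA : (m + n)^2 / (m+n)^3 ≤ 1 / n := by
    have : (m + n)^2 / (m+n)^3 = 1 / (m+n) := by field_simp
    rw [this]; gcongr; linarith
  have hB : (m+n)^3 + 1 ≤ 2 * (m+n)^3 := by
    have : 1 ≤ (m+n)^3 := one_le_pow₀ (by linarith)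
    linarith
  have hC : ((m+n)^3 + 1) * (2 * ((m + n) *
      Real.exp (-((Real.log n)^2 * (n/m) / 2)/4))) ≤ 4 * (2/η)^4 / n := by
    calc _ ≤ (2 * (m+n)^3) * (2 * ((m+n) * (1 / n^5))) := by gcongr
      _ = 4 * (m+n)^4 * (1/n^5) := by ring
      _ ≤ 4 * (2/η*n)^4 * (1/n^5) := by gcongr
      _ = _ := by field_simp
  calc _ ≤ 1 / n + 4 * (2/η)^4 / n := add_le_add hA hC
    _ = _ := by ring

/-- In the two-sample problem, if t is the median of F
(F(t) = 1/2) and `√n ε_n (F̄(t−μ_n) − 1/2) / log n → ∞`, then the two-sample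
higher criticism test rejecting when HC ≥ log n is asymptotically powerful:
its type I error under H0 tends to 0 and its power under H1 tends to 1. -/
theorem stmt_1
    (P : Measure ℝ) [IsProbabilityMeasure P]
    (F : ℝ → ℝ) (hF : ∀ t, F t = (P (Set.Iic t)).toReal) (hFcont : Continuous F)
    (ε μ : ℕ → ℝ) (hε : ∀ n, ε n ∈ Set.Ioo (0:ℝ) (1/2)) (hμ : ∀ n, 0 < μ n)
    (η : ℝ) (hη : η ∈ Set.Ioc (0:ℝ) (1/2))
    (m : ℕ → ℕ) (hmn : ∀ᶠ n in atTop, n ≤ m n)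
    (hcouple : (fun n : ℕ => (n : ℝ) / ((m n : ℝ) + n) - η)
      =O[atTop] fun n => Real.log n / Real.sqrt n)
    (Q : ℕ → Measure ℝ) [∀ n, IsProbabilityMeasure (Q n)]
    (hQ : ∀ n, Q n = ENNReal.ofReal (1 - ε n) • P + ENNReal.ofReal (ε n) • P.map (· + μ n))
    (t : ℝ) (hmed : F t = 1/2)
    (h : Tendsto (fun n : ℕ => Real.sqrt n * ε n * ((1 - F (t - μ n)) - 1/2) /
      Real.log n) atTop atTop) :
    Tendsto (fun n => (((Measure.pi fun _ : Fin (m n) => P).prod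
        (Measure.pi fun _ : Fin n => P))
        {ω | Real.log n ≤ HCstat ω.1 ω.2}).toReal) atTop (𝓝 0) ∧
    Tendsto (fun n => (((Measure.pi fun _ : Fin (m n) => P).prod
        (Measure.pi fun _ : Fin n => Q n))
        {ω | Real.log n ≤ HCstat ω.1 ω.2}).toReal) atTop (𝓝 1) := by
  have hlog : Tendsto (fun n : ℕ => Real.log n) atTop atTop :=
    Real.tendsto_log_atTop.comp tendsto_natCast_atTop_atTop
  constructor
  · have hlim : Tendsto (fun n : ℕ => (n : ℝ) / ((m n : ℝ) + n)) atTop (𝓝 η) := by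
      have h0 : Tendsto (fun n : ℕ => Real.log n / Real.sqrt n) atTop (𝓝 0) := by
        have := (isLittleO_log_rpow_atTop (r := 1/2) (by norm_num)).tendsto_div_nhds_zero
        simp_rw [← Real.sqrt_eq_rpow] at this
        exact this.comp tendsto_natCast_atTop_atTop
      have := (hcouple.trans_tendsto h0).add_const η
      simpa using this
    have hr := hlim.eventually_const_le (show η / 2 < η by linarith [hη.1])
    refine squeeze_zero' (g := fun n : ℕ => (1 + 4 * (2/η)^4) / (n:ℝ))
      (Eventually.of_forall fun n => ENNReal.toReal_nonneg) ?_
      (tendsto_const_div_atTop_nhds_zero_nat _)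
    filter_upwards [hmn, hr, hlog.eventually_ge_atTop (80/η), hlog.eventually_gt_atTop 0,
      eventually_ge_atTop 1] with n h1 h2 h3 h4 h5
    refine (typeI_bound P F hF hFcont h5 h1 _ h4 ((m n + n)^3) (by positivity)).trans ?_
    have := typeI_simple (m := m n) (n := n) (by exact_mod_cast h5) (by exact_mod_cast h1) hη.1 h2 h3
    push_cast
    exact this
  · set δ : ℕ → ℝ := fun n => ε n * ((1 - F (t - μ n)) - 1/2) with hδ
    have hδe : ∀ n, δ n = P.real (Iic t) - (Q n).real (Iic t) := by
      intro n
      have hpre : (fun x => x + μ n) ⁻¹' (Iic t) = Iic (t - μ n) := by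
        ext x; simp [le_sub_iff_add_le]
      have h1 : (Q n).real (Iic t) = (1 - ε n) * F t + ε n * F (t - μ n) := by
        rw [measureReal_def, hQ, Measure.add_apply, Measure.smul_apply, Measure.smul_apply,
          Measure.map_apply (measurable_add_const _) measurableSet_Iic, hpre, hF, hF,
          smul_eq_mul, smul_eq_mul, ENNReal.toReal_add (by finiteness) (by finiteness),
          ENNReal.toReal_mul, ENNReal.toReal_mul,
          ENNReal.toReal_ofReal (by linarith [(hε n).2]), ENNReal.toReal_ofReal (hε n).1.le]
      rw [h1, measureReal_def, ← hF, hmed]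
      simp only [hδ]
      ring
    have hh : Tendsto (fun n : ℕ => Real.sqrt n * δ n / Real.log n) atTop atTop := by
      refine h.congr fun n => ?_
      simp only [hδ]
      ring
    have hs : Tendsto (fun n : ℕ => Real.sqrt n * δ n) atTop atTop := by
      refine tendsto_atTop_mono' _ ?_ hh
      filter_upwards [hlog.eventually_ge_atTop 1, hh.eventually_ge_atTop 0] with n h1 h2
      have := mul_le_mul_of_nonneg_left h1 h2
      rwa [div_mul_cancel₀ _ (by linarith), mul_one] at this
    have hsq : Tendsto (fun n : ℕ => 1 - 8 / (n * (δ n)^2)) atTop (𝓝 1) := by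
      have h1 : Tendsto (fun n : ℕ => (Real.sqrt n * δ n)^2) atTop atTop :=
        (tendsto_pow_atTop (by norm_num)).comp hs
      have h2 := (h1.const_div_atTop 8).const_sub 1
      rw [sub_zero] at h2
      refine h2.congr fun n => ?_
      rw [mul_pow, Real.sq_sqrt (by positivity)]
    refine tendsto_of_tendsto_of_tendsto_of_le_of_le' hsq tendsto_const_nhds ?_
      (Eventually.of_forall fun n => ?_)
    · filter_upwards [hmn, eventually_ge_atTop 1, hlog.eventually_ge_atTop 1,
        hh.eventually_ge_atTop 2, hs.eventually_gt_atTop 0] with n h1 h2 h3 h4 h5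
      refine power_bound P (Q n) h2 h1 _ t (δ n) (hδe n) ?_ ?_
      · exact pos_of_mul_pos_right h5 (Real.sqrt_nonneg _)
      · rwa [le_div_iff₀ (by linarith)] at h4
    · exact measureReal_le_one
end

section
/- Consider the two-sample testing problem with alternative parameters ε = ε_n ∈ (0,1/2) and μ = μ_n > 0 possibly varying with n. If √n ε_n (1/2 − ∫ F(x − μ_n) dF(x)) / log n → ∞, then the Wilcoxon test that rejects when U − mn/2 ≥ log n · √((m+n+1)mn/12) is asymptotically powerful: its type I error probability under H0 tends to 0 and its power under H1 tends to 1 as n → ∞. -/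
open MeasureTheory ProbabilityTheory Filter Set Topology

/-- The Mann–Whitney/Wilcoxon statistic: the number of pairs (i,j) with X_i < Y_j. -/
noncomputable def Ustat {m n : ℕ} (x : Fin m → ℝ) (y : Fin n → ℝ) : ℕ :=
  ((Finset.univ ×ˢ Finset.univ).filter fun p : Fin m × Fin n => x p.1 < y p.2).card

theorem pi_mul_aux {n : ℕ} (Q : Measure ℝ) [IsProbabilityMeasure Q] (f g : ℝ → ℝ)
    (hf : Measurable f) (hg : Measurable g) {j l : Fin n} (hjl : j ≠ l) :
    ∫ y, f (y j) * g (y l) ∂(Measure.pi fun _ : Fin n => Q) = (∫ t, f t ∂Q) * ∫ t, g t ∂Q := by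
  have hI : iIndepFun (fun (i : Fin n) (y : Fin n → ℝ) => y i) (Measure.pi fun _ : Fin n => Q) :=
    iIndepFun_pi (X := fun _ t => t) (fun _ => aemeasurable_id)
  have h2 := (hI.indepFun hjl).comp hf hg
  have h3 := h2.integral_mul_eq_mul_integral (by exact (hf.comp (measurable_pi_apply j)).aestronglyMeasurable) (by exact (hg.comp (measurable_pi_apply l)).aestronglyMeasurable)
  have e1 : ∀ (f : ℝ → ℝ) (_ : Measurable f) (j : Fin n), ∫ y, f (y j) ∂(Measure.pi fun _ : Fin n => Q) = ∫ t, f t ∂Q := by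
    intro f hf j
    exact integral_comp_eval (μ := fun _ : Fin n => Q) hf.aestronglyMeasurable
  rw [← e1 f hf j, ← e1 g hg l]
  exact h3

noncomputable def xi (p x y : ℝ) : ℝ := (if x < y then 1 else 0) - p

theorem xi_meas (p : ℝ) : Measurable (fun q : ℝ × ℝ => xi p q.1 q.2) := by
  unfold xi
  exact (Measurable.ite (measurableSet_lt measurable_fst measurable_snd) measurable_const measurable_const).sub_const p

theorem xi_bd (p x y : ℝ) (h0 : 0 ≤ p) (h1 : p ≤ 1) : |xi p x y| ≤ 1 := by
  unfold xi
  rw [abs_le]; split_ifs <;> constructor <;> linarith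

theorem second_moment (P Q : Measure ℝ) [IsProbabilityMeasure P] [IsProbabilityMeasure Q] (m n : ℕ)
    (p : ℝ) (hp : p = ((P.prod Q) {q | q.1 < q.2}).toReal) :
    Integrable (fun ω => ((Ustat ω.1 ω.2 : ℝ) - m * n * p) ^ 2) ((Measure.pi fun _ : Fin m => P).prod
        (Measure.pi fun _ : Fin n => Q)) ∧ 
    ∫ ω, ((Ustat ω.1 ω.2 : ℝ) - m * n * p) ^ 2 ∂((Measure.pi fun _ : Fin m => P).prod
        (Measure.pi fun _ : Fin n => Q)) ≤ m * n * (m + n) := by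
  have h0 : 0 ≤ p := hp ▸ ENNReal.toReal_nonneg
  have h1 : p ≤ 1 := by
    rw [hp]; exact measureReal_le_one (μ := P.prod Q)
  set M := (Measure.pi fun _ : Fin m => P).prod (Measure.pi fun _ : Fin n => Q) with hM
  have hU : ∀ ω : (Fin m → ℝ) × (Fin n → ℝ), ((Ustat ω.1 ω.2 : ℝ) - m * n * p) ^ 2 =
      ∑ a : Fin m × Fin n, ∑ b : Fin m × Fin n, xi p (ω.1 a.1) (ω.2 a.2) * xi p (ω.1 b.1) (ω.2 b.2) := by
    intro ω
    rw [← Finset.sum_mul_sum, ← sq]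
    congr 1
    simp only [xi, Finset.sum_sub_distrib, Ustat, Finset.card_filter, Finset.univ_product_univ]
    simp
  have hxm : ∀ a : Fin m × Fin n, Measurable (fun ω : (Fin m → ℝ) × (Fin n → ℝ) => xi p (ω.1 a.1) (ω.2 a.2)) := by
    intro a
    exact (xi_meas p).comp (f := fun ω : (Fin m → ℝ) × (Fin n → ℝ) => (ω.1 a.1, ω.2 a.2)) (((measurable_pi_apply a.1).comp measurable_fst).prodMk ((measurable_pi_apply a.2).comp measurable_snd))
  have hbd : ∀ (a b : Fin m × Fin n) (ω : (Fin m → ℝ) × (Fin n → ℝ)), |xi p (ω.1 a.1) (ω.2 a.2) * xi p (ω.1 b.1) (ω.2 b.2)| ≤ 1 := by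
    intro a b ω
    rw [abs_mul]
    exact mul_le_one₀ (xi_bd _ _ _ h0 h1) (abs_nonneg _) (xi_bd _ _ _ h0 h1)
  have hint : ∀ a b : Fin m × Fin n, Integrable (fun ω : (Fin m → ℝ) × (Fin n → ℝ) => xi p (ω.1 a.1) (ω.2 a.2) * xi p (ω.1 b.1) (ω.2 b.2)) M := by
    intro a b
    exact Integrable.of_bound ((hxm a).mul (hxm b)).aestronglyMeasurable 1 (ae_of_all _ (hbd a b))
  simp only [hU]
  refine ⟨integrable_finsetSum _ fun a _ => integrable_finsetSum _ fun b _ => hint a b, ?_⟩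
  rw [integral_finsetSum _ fun a _ => integrable_finsetSum _ fun b _ => hint a b]
  simp_rw [fun a => integral_finsetSum (μ := M) Finset.univ (fun b _ => hint a b)]
  have hA : ∫ x, ∫ y, xi p x y ∂Q ∂P = 0 := by
    have hi : Integrable (fun q : ℝ × ℝ => xi p q.1 q.2) (P.prod Q) :=
      Integrable.of_bound (xi_meas p).aestronglyMeasurable 1 (ae_of_all _ fun q => xi_bd p _ _ h0 h1)
    rw [← integral_prod (fun q : ℝ × ℝ => xi p q.1 q.2) hi]
    have hs : MeasurableSet {q : ℝ × ℝ | q.1 < q.2} := measurableSet_lt measurable_fst measurable_snd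
    have : (fun q : ℝ × ℝ => xi p q.1 q.2) = fun q => ({q : ℝ × ℝ | q.1 < q.2}.indicator 1 q : ℝ) - p := by
      ext q; simp [xi, Set.indicator_apply]
    rw [this, integral_sub (f := fun q => ({q : ℝ × ℝ | q.1 < q.2}.indicator 1 q : ℝ)) ((integrable_const (1:ℝ)).indicator hs) (integrable_const p), integral_indicator_one hs]
    simp [hp, Measure.real]
  have hAm : Measurable (fun x => ∫ y, xi p x y ∂Q) :=
    ((xi_meas p).stronglyMeasurable.integral_prod_right (ν := Q)).measurable
  have key : ∀ a b : Fin m × Fin n, ∫ ω, xi p (ω.1 a.1) (ω.2 a.2) * xi p (ω.1 b.1) (ω.2 b.2) ∂M ≤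
      (if a.1 = b.1 then 1 else 0) + (if a.2 = b.2 then 1 else 0) := by
    intro a b
    by_cases hab : a.1 ≠ b.1 ∧ a.2 ≠ b.2
    · rw [hM, integral_prod _ (hint a b)]
      have : ∀ x : Fin m → ℝ, ∫ y, xi p (x a.1) (y a.2) * xi p (x b.1) (y b.2) ∂(Measure.pi fun _ : Fin n => Q)
          = (∫ y, xi p (x a.1) y ∂Q) * ∫ y, xi p (x b.1) y ∂Q := fun x =>
        pi_mul_aux Q (fun y => xi p (x a.1) y) (fun y => xi p (x b.1) y)
          ((xi_meas p).comp measurable_prodMk_left) ((xi_meas p).comp measurable_prodMk_left) hab.2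
      simp only [this]
      rw [pi_mul_aux P _ _ hAm hAm hab.1, hA]
      simp [hab.1, hab.2]
    · have h2 : ∫ ω, xi p (ω.1 a.1) (ω.2 a.2) * xi p (ω.1 b.1) (ω.2 b.2) ∂M ≤ 1 := by
        calc _ ≤ ∫ ω, (1:ℝ) ∂M := integral_mono (hint a b) (integrable_const _) fun ω => (abs_le.1 (hbd a b ω)).2
          _ = 1 := by simp
      refine h2.trans ?_
      split_ifs with h3 h4 h5
      · norm_num
      · norm_num
      · norm_num
      · exact absurd ⟨h3, h5⟩ hab
  refine (Finset.sum_le_sum fun a _ => Finset.sum_le_sum fun b _ => key a b).trans (le_of_eq ?_)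
  have e1 : ∀ a : Fin m × Fin n, ∑ b : Fin m × Fin n, (if a.1 = b.1 then (1:ℝ) else 0) = n := by
    intro a
    rw [Fintype.sum_prod_type, Finset.sum_comm]
    simp
  have e2 : ∀ a : Fin m × Fin n, ∑ b : Fin m × Fin n, (if a.2 = b.2 then (1:ℝ) else 0) = m := by
    intro a
    rw [Fintype.sum_prod_type]
    simp
  simp only [Finset.sum_add_distrib, e1, e2]
  simp
  ring

theorem cheb (P Q : Measure ℝ) [IsProbabilityMeasure P] [IsProbabilityMeasure Q] (m n : ℕ)
    (p : ℝ) (hp : p = ((P.prod Q) {q | q.1 < q.2}).toReal) (hm : 0 < m) (hn : 2 ≤ n)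
    (S : Set ((Fin m → ℝ) × (Fin n → ℝ)))
    (hS : ∀ ω ∈ S, Real.log n * Real.sqrt ((((m : ℝ) + n + 1) * m * n) / 12) ≤ 
      |(Ustat ω.1 ω.2 : ℝ) - m * n * p|) :
    (((Measure.pi fun _ : Fin m => P).prod (Measure.pi fun _ : Fin n => Q)) S).toReal ≤ 12 / Real.log n ^ 2 := by
  obtain ⟨hi, hv⟩ := second_moment P Q m n p hp
  set M := (Measure.pi fun _ : Fin m => P).prod (Measure.pi fun _ : Fin n => Q) with hM
  have hl : 0 < Real.log n := Real.log_pos (by exact_mod_cast hn)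
  have hm' : (0:ℝ) < m := by exact_mod_cast hm
  have hn' : (0:ℝ) < n := by positivity
  set c := (Real.log n)^2 * ((((m : ℝ) + n + 1) * m * n) / 12) with hc
  have hc0 : 0 < c := by positivity
  have hmk := mul_meas_ge_le_integral_of_nonneg (μ := M) (ae_of_all _ fun ω => sq_nonneg ((Ustat ω.1 ω.2 : ℝ) - m * n * p)) hi c
  have hsub : M.real S ≤ M.real {ω | c ≤ ((Ustat ω.1 ω.2 : ℝ) - m * n * p) ^ 2} := by
    refine measureReal_mono ?_ (measure_ne_top _ _)
    intro ω hω
    have := pow_le_pow_left₀ (by positivity) (hS ω hω) 2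
    rw [mul_pow, Real.sq_sqrt (by positivity), sq_abs] at this
    exact this
  have h3 : M.real S * c ≤ m * n * (m + n) := by
    nlinarith [hmk, hv, hsub]
  change M.real S ≤ _
  rw [le_div_iff₀ (by positivity)]
  have : M.real S * Real.log n ^ 2 * (m * n * (m + n + 1)) ≤ 12 * (m * n * (m + n + 1)) := by
    have : M.real S * c = M.real S * Real.log n ^ 2 * (m * n * (m + n + 1)) / 12 := by rw [hc]; ring
    nlinarith [mul_pos hm' hn']
  exact le_of_mul_le_mul_right this (by positivity)

theorem p_shift (P : Measure ℝ) [IsProbabilityMeasure P]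
    (F : ℝ → ℝ) (hF : ∀ t, F t = (P (Set.Iic t)).toReal) (s : ℝ) :
    ((P.prod (P.map (· + s))) {q | q.1 < q.2}).toReal = 1 - ∫ x, F (x - s) ∂P := by
  have hs : MeasurableSet {q : ℝ × ℝ | q.1 < q.2} := measurableSet_lt measurable_fst measurable_snd
  have : IsProbabilityMeasure (P.map (· + s)) := Measure.isProbabilityMeasure_map (by fun_prop)
  have hFm : Measurable F := by
    have : Monotone F := by
      intro a b hab
      rw [hF, hF]
      exact measureReal_mono (μ := P) (Set.Iic_subset_Iic.2 hab)
    exact this.measurable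
  have hFb : ∀ t, 0 ≤ F t ∧ F t ≤ 1 := fun t => by
    rw [hF]; exact ⟨ENNReal.toReal_nonneg, measureReal_le_one (μ := P)⟩
  have hint : Integrable (fun x => F (x - s)) P :=
    Integrable.of_bound (hFm.comp (measurable_id.sub_const s)).aestronglyMeasurable 1
      (ae_of_all _ fun x => by rw [Real.norm_eq_abs, abs_of_nonneg (hFb _).1]; exact (hFb _).2)
  have h1 : ∀ x, (P.map (· + s)) (Prod.mk x ⁻¹' {q : ℝ × ℝ | q.1 < q.2}) = ENNReal.ofReal (1 - F (x - s)) := by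
    intro x
    rw [Measure.map_apply (by fun_prop) (measurable_prodMk_left hs)]
    have : ((· + s) ⁻¹' (Prod.mk x ⁻¹' {q : ℝ × ℝ | q.1 < q.2})) = (Set.Iic (x - s))ᶜ := by
      ext y; simp [sub_lt_iff_lt_add]
    rw [this, hF, ← ENNReal.ofReal_toReal (measure_ne_top P (Set.Iic (x - s))ᶜ)]
    congr 1
    exact probReal_compl_eq_one_sub (μ := P) measurableSet_Iic
  rw [Measure.prod_apply hs]
  simp_rw [h1]
  rw [← integral_toReal]
  · have : ∀ x, (ENNReal.ofReal (1 - F (x - s))).toReal = 1 - F (x - s) := fun x =>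
      ENNReal.toReal_ofReal (by linarith [(hFb (x - s)).2])
    simp_rw [this]
    rw [integral_sub (integrable_const _) hint]
    simp
  · exact (ENNReal.measurable_ofReal.comp (measurable_const.sub (hFm.comp (measurable_id.sub_const s)))).aemeasurable
  · exact ae_of_all _ fun x => ENNReal.ofReal_lt_top

theorem p_null (P : Measure ℝ) [IsProbabilityMeasure P]
    (F : ℝ → ℝ) (hF : ∀ t, F t = (P (Set.Iic t)).toReal) (hFcont : Continuous F) :
    (1/2 : ℝ) = ((P.prod P) {q | q.1 < q.2}).toReal := by
  have hs : MeasurableSet {q : ℝ × ℝ | q.1 < q.2} := measurableSet_lt measurable_fst measurable_snd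
  have hat : ∀ x, P {x} = 0 := by
    intro x
    have hle : ∀ k : ℕ, (P {x}).toReal ≤ F x - F (x - 1 / ((k:ℝ) + 1)) := by
      intro k
      have hk : (0:ℝ) < 1 / ((k:ℝ) + 1) := by positivity
      have : (P.real {x}) + P.real (Set.Iic (x - 1 / ((k:ℝ) + 1))) ≤ P.real (Set.Iic x) := by
        rw [← measureReal_union _ measurableSet_Iic]
        · refine measureReal_mono ?_ (measure_ne_top _ _)
          intro y hy
          rcases hy with hy | hy
          · exact le_of_eq hy
          · have := Set.mem_Iic.1 hy
            exact Set.mem_Iic.2 (by linarith)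
        · rw [Set.disjoint_singleton_left]
          intro hy
          have := Set.mem_Iic.1 hy
          linarith
      rw [hF, hF]
      simp only [Measure.real] at this
      linarith
    have hlim : Tendsto (fun k : ℕ => F x - F (x - 1 / ((k:ℝ) + 1))) atTop (𝓝 0) := by
      have h1 : Tendsto (fun k : ℕ => x - 1 / ((k:ℝ) + 1)) atTop (𝓝 (x - 0)) :=
        tendsto_const_nhds.sub tendsto_one_div_add_atTop_nhds_zero_nat
      rw [sub_zero] at h1
      have := (tendsto_const_nhds (x := F x)).sub ((hFcont.tendsto x).comp h1)
      rw [sub_self] at this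
      exact this
    have h0 : (P {x}).toReal ≤ 0 := ge_of_tendsto' hlim hle
    have := le_antisymm h0 ENNReal.toReal_nonneg
    exact ((ENNReal.toReal_eq_zero_iff _).1 this).resolve_right (measure_ne_top _ _)
  have hd : (P.prod P).real {q | q.1 = q.2} = 0 := by
    have hm : MeasurableSet {q : ℝ × ℝ | q.1 = q.2} := measurableSet_eq_fun measurable_fst measurable_snd
    have : (P.prod P) {q | q.1 = q.2} = 0 := by
      rw [Measure.prod_apply hm]
      have : ∀ x, P (Prod.mk x ⁻¹' {q : ℝ × ℝ | q.1 = q.2}) = 0 := by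
        intro x
        have : Prod.mk x ⁻¹' {q : ℝ × ℝ | q.1 = q.2} = {x} := by ext y; simp [eq_comm]
        rw [this, hat]
      simp only [this, lintegral_zero]
    simp [Measure.real, this]
  have hsw : (P.prod P).real {q | q.2 < q.1} = (P.prod P).real {q | q.1 < q.2} := by
    have h1 := Measure.prod_swap (μ := P) (ν := P)
    have h2 : (P.prod P) {q | q.1 < q.2} = ((P.prod P).map Prod.swap) {q | q.1 < q.2} := by rw [h1]
    rw [Measure.map_apply measurable_swap hs] at h2
    simp only [Measure.real]
    rw [h2]; rfl
  have hc : (P.prod P).real {q | q.1 < q.2}ᶜ = 1 - (P.prod P).real {q | q.1 < q.2} := probReal_compl_eq_one_sub hs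
  have hu : ({q : ℝ × ℝ | q.1 < q.2}ᶜ) = {q | q.2 < q.1} ∪ {q | q.1 = q.2} := by
    ext q; simp [le_iff_lt_or_eq, eq_comm]
  have h3 : (P.prod P).real ({q | q.2 < q.1} ∪ {q | q.1 = q.2}) = (P.prod P).real {q | q.2 < q.1} := by
    apply le_antisymm
    · have := measureReal_union_le (μ := P.prod P) {q | q.2 < q.1} {q | q.1 = q.2}
      linarith
    · exact measureReal_mono Set.subset_union_left
  rw [hu, h3, hsw] at hc
  change _ = (P.prod P).real _
  linarith

theorem p_alt (P : Measure ℝ) [IsProbabilityMeasure P]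
    (F : ℝ → ℝ) (hF : ∀ t, F t = (P (Set.Iic t)).toReal) (hFcont : Continuous F)
    (e s : ℝ) (he0 : 0 < e) (he1 : e < 1/2) (Q : Measure ℝ) [IsProbabilityMeasure Q]
    (hQ : Q = ENNReal.ofReal (1 - e) • P + ENNReal.ofReal e • P.map (· + s)) :
    1/2 + e * (1/2 - ∫ x, F (x - s) ∂P) = ((P.prod Q) {q | q.1 < q.2}).toReal := by
  have : IsProbabilityMeasure (P.map (· + s)) := Measure.isProbabilityMeasure_map (by fun_prop)
  have h1 := p_null P F hF hFcont
  have h2 := p_shift P F hF s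
  subst hQ
  rw [Measure.prod_add, Measure.prod_smul_right, Measure.prod_smul_right]
  simp only [Measure.coe_add, Measure.coe_smul, Pi.add_apply, Pi.smul_apply, smul_eq_mul]
  rw [ENNReal.toReal_add (by finiteness) (by finiteness), ENNReal.toReal_mul, ENNReal.toReal_mul,
    ← h1, h2, ENNReal.toReal_ofReal (by linarith), ENNReal.toReal_ofReal he0.le]
  ring

/-- In the two-sample problem, if
`√n ε_n (1/2 − ∫ F(x−μ_n) dF(x)) / log n → ∞`, then the Wilcoxon test rejecting
when `U − mn/2 ≥ log n · √((m+n+1)mn/12)` is asymptotically powerful: its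
type I error under H0 tends to 0 and its power under H1 tends to 1. -/
theorem stmt_2
    (P : Measure ℝ) [IsProbabilityMeasure P]
    (F : ℝ → ℝ) (hF : ∀ t, F t = (P (Set.Iic t)).toReal) (hFcont : Continuous F)
    (ε μ : ℕ → ℝ) (hε : ∀ n, ε n ∈ Set.Ioo (0:ℝ) (1/2)) (hμ : ∀ n, 0 < μ n)
    (η : ℝ) (hη : η ∈ Set.Ioc (0:ℝ) (1/2))
    (m : ℕ → ℕ) (hmn : ∀ᶠ n in atTop, n ≤ m n)
    (hcouple : (fun n : ℕ => (n : ℝ) / ((m n : ℝ) + n) - η)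
      =O[atTop] fun n => Real.log n / Real.sqrt n)
    (Q : ℕ → Measure ℝ) [∀ n, IsProbabilityMeasure (Q n)]
    (hQ : ∀ n, Q n = ENNReal.ofReal (1 - ε n) • P + ENNReal.ofReal (ε n) • P.map (· + μ n))
    (h : Tendsto (fun n : ℕ => Real.sqrt n * ε n *
      (1/2 - ∫ x, F (x - μ n) ∂P) / Real.log n) atTop atTop) :
    Tendsto (fun n => (((Measure.pi fun _ : Fin (m n) => P).prod
        (Measure.pi fun _ : Fin n => P))
        {ω | Real.log n * Real.sqrt ((((m n : ℝ) + n + 1) * (m n) * n) / 12) ≤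
          (Ustat ω.1 ω.2 : ℝ) - (m n : ℝ) * n / 2}).toReal) atTop (𝓝 0) ∧
    Tendsto (fun n => (((Measure.pi fun _ : Fin (m n) => P).prod
        (Measure.pi fun _ : Fin n => Q n))
        {ω | Real.log n * Real.sqrt ((((m n : ℝ) + n + 1) * (m n) * n) / 12) ≤
          (Ustat ω.1 ω.2 : ℝ) - (m n : ℝ) * n / 2}).toReal) atTop (𝓝 1) := by
  have hlog : Tendsto (fun n : ℕ => 12 / Real.log n ^ 2) atTop (𝓝 0) := by
    have h1 : Tendsto (fun n : ℕ => Real.log n) atTop atTop :=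
      Real.tendsto_log_atTop.comp tendsto_natCast_atTop_atTop
    exact Tendsto.div_atTop tendsto_const_nhds ((tendsto_pow_atTop two_ne_zero).comp h1)
  constructor
  · refine squeeze_zero' (Eventually.of_forall fun n => ENNReal.toReal_nonneg) ?_ hlog
    filter_upwards [hmn, eventually_ge_atTop 2] with n hn hn2
    apply cheb P P (m n) n (1/2) (p_null P F hF hFcont) (by omega) hn2
    intro ω hω
    refine le_trans hω (le_trans (le_of_eq ?_) (le_abs_self _))
    ring
  · have hlow : Tendsto (fun n : ℕ => 1 - 12 / Real.log n ^ 2) atTop (𝓝 1) := by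
      simpa using (tendsto_const_nhds (x := (1:ℝ))).sub hlog
    refine tendsto_of_tendsto_of_tendsto_of_le_of_le' hlow tendsto_const_nhds ?_
      (Eventually.of_forall fun n => measureReal_le_one (μ := (Measure.pi fun _ : Fin (m n) => P).prod
        (Measure.pi fun _ : Fin n => Q n)))
    filter_upwards [hmn, eventually_ge_atTop 2, h.eventually_ge_atTop 1] with n hn hn2 hK
    set M := (Measure.pi fun _ : Fin (m n) => P).prod (Measure.pi fun _ : Fin n => Q n) with hM
    set S := {ω : (Fin (m n) → ℝ) × (Fin n → ℝ) | Real.log n * Real.sqrt ((((m n : ℝ) + n + 1) * (m n) * n) / 12) ≤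
          (Ustat ω.1 ω.2 : ℝ) - (m n : ℝ) * n / 2} with hSdef
    set d := 1/2 - ∫ x, F (x - μ n) ∂P with hd
    have hl : 0 < Real.log n := Real.log_pos (by exact_mod_cast hn2)
    have hn' : (2:ℝ) ≤ n := by exact_mod_cast hn2
    have hmn' : (n:ℝ) ≤ m n := by exact_mod_cast hn
    have hc : (M Sᶜ).toReal ≤ 12 / Real.log n ^ 2 := by
      apply cheb P (Q n) (m n) n _ (p_alt P F hF hFcont (ε n) (μ n) (hε n).1 (hε n).2 (Q n) (hQ n)) (by omega) hn2
      intro ω hω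
      have hω' : (Ustat ω.1 ω.2 : ℝ) - (m n : ℝ) * n / 2 < Real.log n * Real.sqrt ((((m n : ℝ) + n + 1) * (m n) * n) / 12) := lt_of_not_ge fun h' => hω h'
      rw [one_le_div hl] at hK
      set r := Real.sqrt n with hr
      have hr2 : r * r = n := Real.mul_self_sqrt (by positivity)
      have hr0 : 0 ≤ r := Real.sqrt_nonneg _
      have hT : Real.sqrt ((((m n : ℝ) + n + 1) * (m n) * n) / 12) ≤ m n * r / 2 := by
        rw [Real.sqrt_le_left (by positivity)]
        have : (m n * r / 2)^2 = (m n : ℝ)^2 * n / 4 := by rw [← hr2]; ring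
        rw [this]
        have : (m n : ℝ) * n * (m n + n + 1) ≤ (m n : ℝ) * n * (3 * m n) := by
          apply mul_le_mul_of_nonneg_left _ (by positivity)
          linarith
        linarith
      have hT2 := mul_le_mul_of_nonneg_left hT hl.le
      have h5 : (m n : ℝ) * r * Real.log n ≤ m n * r * (r * ε n * d) :=
        mul_le_mul_of_nonneg_left hK (by positivity)
      have h6 : (m n : ℝ) * r * (r * ε n * d) = m n * n * (ε n * d) := by rw [← hr2]; ring
      refine le_trans ?_ (neg_le_abs _)
      rw [← hd]
      linarith
    have hSm : MeasurableSet S := by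
      have : Measurable (fun ω : (Fin (m n) → ℝ) × (Fin n → ℝ) => (Ustat ω.1 ω.2 : ℝ)) := by
        simp only [Ustat, Finset.card_filter, Nat.cast_sum]
        refine Finset.measurable_sum _ fun a _ => ?_
        have : MeasurableSet {ω : (Fin (m n) → ℝ) × (Fin n → ℝ) | ω.1 a.1 < ω.2 a.2} :=
          measurableSet_lt (by fun_prop) (by fun_prop)
        simp only [Nat.cast_ite, Nat.cast_one, Nat.cast_zero]
        exact Measurable.ite this measurable_const measurable_const
      exact measurableSet_le measurable_const (this.sub_const _)
    have hcc : M.real Sᶜ = 1 - M.real S := probReal_compl_eq_one_sub hSm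
    simp only [Measure.real] at hcc
    linarith
end
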